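/- arXiv:1509.01813 — 2 statements merged into one kernel-verified Lean document; each statement's English description precedes it below -/
import Mathlib

section
/- Let h_0 ∈ K[x_1,...,x_n] be a polynomial of degree one and I an ideal of R = K[x]. Let R' = R/(h_0) and I' = (I + Rh_0)/Rh_0. Then for every integer i, the length of H^i_{I+Rh_0}(R) as a left D_n-module equals the length of H^{i-1}_{I'}(R') as a left D_{n-1}-module. -/
open Polynomial MvPolynomial

/-- Defining relations of the `n`-th Weyl algebra over `K`:
generators `Sum.inl i` are the multiplication operators `x_i`, generators
`Sum.inr i` are the partial derivations `∂_i`. -/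
inductive WeylRel (K : Type) [Field K] (n : ℕ) :
    FreeAlgebra K (Fin n ⊕ Fin n) → FreeAlgebra K (Fin n ⊕ Fin n) → Prop
  | xx (i j : Fin n) : WeylRel K n
      (FreeAlgebra.ι K (Sum.inl i) * FreeAlgebra.ι K (Sum.inl j))
      (FreeAlgebra.ι K (Sum.inl j) * FreeAlgebra.ι K (Sum.inl i))
  | dd (i j : Fin n) : WeylRel K n
      (FreeAlgebra.ι K (Sum.inr i) * FreeAlgebra.ι K (Sum.inr j))
      (FreeAlgebra.ι K (Sum.inr j) * FreeAlgebra.ι K (Sum.inr i))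
  | dx (i j : Fin n) : WeylRel K n
      (FreeAlgebra.ι K (Sum.inr i) * FreeAlgebra.ι K (Sum.inl j))
      (FreeAlgebra.ι K (Sum.inl j) * FreeAlgebra.ι K (Sum.inr i)
        + if i = j then 1 else 0)

/-- The `n`-th Weyl algebra `D_n` over `K`. -/
abbrev Weyl (K : Type) [Field K] (n : ℕ) : Type := RingQuot (WeylRel K n)

/-- The operator `x_i ∈ D_n`. -/
noncomputable def wX (K : Type) [Field K] (n : ℕ) (i : Fin n) : Weyl K n :=
  RingQuot.mkAlgHom K (WeylRel K n) (FreeAlgebra.ι K (Sum.inl i))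

/-- The operator `∂_i ∈ D_n`. -/
noncomputable def wD (K : Type) [Field K] (n : ℕ) (i : Fin n) : Weyl K n :=
  RingQuot.mkAlgHom K (WeylRel K n) (FreeAlgebra.ι K (Sum.inr i))

/-- The Bernstein filtration on the Weyl algebra: `F_k(D_n)` is spanned by the
monomials `x^α ∂^β` with `|α| + |β| ≤ k`. -/
noncomputable def bernsteinF (K : Type) [Field K] (n : ℕ) (k : ℤ) :
    Submodule K (Weyl K n) :=
  Submodule.span K {w | ∃ α β : Fin n → ℕ,
    ((∑ i, α i : ℕ) + (∑ i, β i : ℕ) : ℤ) ≤ k ∧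
    w = ((List.finRange n).map fun i => wX K n i ^ α i).prod *
        ((List.finRange n).map fun i => wD K n i ^ β i).prod}

/-- A good Bernstein filtration on a left `D_n`-module `M`. -/
structure GoodFiltration (K : Type) [Field K] (n : ℕ) (M : Type)
    [AddCommGroup M] [Module K M] [Module (Weyl K n) M]
    [IsScalarTower K (Weyl K n) M] (F : ℤ → Submodule K M) : Prop where
  mono : ∀ k, F k ≤ F (k + 1)
  exhaustive : ∀ m : M, ∃ k, m ∈ F k
  compat : ∀ j k : ℤ, ∀ w ∈ bernsteinF K n j, ∀ m ∈ F k, w • m ∈ F (j + k)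
  bddBelow : ∃ k₀ : ℤ, ∀ k < k₀, F k = ⊥
  finiteDim : ∀ k, FiniteDimensional K (F k)
  good : ∃ k₁ : ℤ, ∀ k ≥ k₁, ∀ j ≥ (0 : ℤ),
    F (j + k) ≤ Submodule.span K
      {m | ∃ w ∈ bernsteinF K n j, ∃ v ∈ F k, m = w • v}

/-- `HasMult K n M m` : the holonomic module `M` admits a good Bernstein filtration
whose Hilbert polynomial `h` satisfies `(deg h)! · (leading coeff of h) = m`; i.e.
the multiplicity of `M` is `m`. -/
def HasMult (K : Type) [Field K] (n : ℕ) (M : Type)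
    [AddCommGroup M] [Module K M] [Module (Weyl K n) M]
    [IsScalarTower K (Weyl K n) M] (m : ℚ) : Prop :=
  ∃ F : ℤ → Submodule K M, GoodFiltration K n M F ∧
    ∃ h : Polynomial ℚ,
      (∃ N : ℤ, ∀ k ≥ N, (Module.finrank K (F k) : ℚ) = h.eval (k : ℚ)) ∧
      m = (Nat.factorial h.natDegree : ℚ) * h.leadingCoeff

/-- `M` is a holonomic left `D_n`-module. -/
def IsHolonomic (K : Type) [Field K] (n : ℕ) (M : Type)
    [AddCommGroup M] [Module K M] [Module (Weyl K n) M]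
    [IsScalarTower K (Weyl K n) M] : Prop :=
  Subsingleton M ∨
  ∃ F : ℤ → Submodule K M, GoodFiltration K n M F ∧
    ∃ h : Polynomial ℚ,
      (∃ N : ℤ, ∀ k ≥ N, (Module.finrank K (F k) : ℚ) = h.eval (k : ℚ)) ∧
      h.natDegree = n

/-- The length of a module: the Krull dimension of its lattice of submodules. -/
noncomputable def mlength (A : Type) [Ring A] (M : Type) [AddCommGroup M]
    [Module A M] : WithBot ℕ∞ :=
  Order.krullDim (Submodule A M)

section LocalCoh
variable (K : Type) [Field K] (n : ℕ)

/-- The zero set in `K^n` of a polynomial. -/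
def zeroSet (p : MvPolynomial (Fin n) K) : Set (Fin n → K) :=
  {x | MvPolynomial.eval x p = 0}

/-- The property that a given `D_n`-module structure on the localization
`R[f⁻¹]` is the natural one: `x_i` acts by multiplication and `∂_i` acts as the
(unique) derivation of `R[f⁻¹]` extending `∂/∂x_i` on `R`. -/
def NatActs (f : MvPolynomial (Fin n) K)
    [Module (Weyl K n) (Localization.Away f)] : Prop :=
  (∀ (i : Fin n) (m : Localization.Away f),
      wX K n i • m =
        algebraMap (MvPolynomial (Fin n) K) (Localization.Away f)
          (MvPolynomial.X i) * m) ∧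
  (∀ i : Fin n, ∃ δ : Derivation K (Localization.Away f) (Localization.Away f),
      (∀ m, wD K n i • m = δ m) ∧
      ∀ r : MvPolynomial (Fin n) K,
        δ (algebraMap (MvPolynomial (Fin n) K) (Localization.Away f) r) =
          algebraMap (MvPolynomial (Fin n) K) (Localization.Away f)
            (MvPolynomial.pderiv i r))

/-- The first local cohomology module `H¹_{(f)}(R) = R[f⁻¹]/R` as a left
`D_n`-module. -/
noncomputable abbrev H1 (f : MvPolynomial (Fin n) K)
    [Module (Weyl K n) (Localization.Away f)] : Type :=
  (Localization.Away f) ⧸ Submodule.span (Weyl K n)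
    (Set.range (algebraMap (MvPolynomial (Fin n) K) (Localization.Away f)))

end LocalCoh

section Arrangement
open scoped Classical
variable (K : Type) [Field K] (n : ℕ)

/-- The intersection poset of an arrangement `𝒜` of hyperplanes inside the
ambient affine subspace `V0`: all nonempty intersections of subfamilies
(including the ambient space `V0` itself, as the empty intersection). -/
noncomputable def interPoset (V0 : Set (Fin n → K))
    (𝒜 : Finset (Set (Fin n → K))) : Finset (Set (Fin n → K)) :=
  (𝒜.powerset.image fun S => V0 ∩ ⋂ H ∈ S, H).filter fun X => X ≠ ∅

/-- Codimension of `X` inside the ambient affine subspace `V0`. -/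
noncomputable def codim (V0 X : Set (Fin n → K)) : ℕ :=
  Module.finrank K (vectorSpan K V0) - Module.finrank K (vectorSpan K X)

/-- `μ` is the Möbius function of the intersection poset of `𝒜` (with ambient
space `V0`), for the order `X ≤ Y ↔ X ⊇ Y`. -/
def IsMobius (V0 : Set (Fin n → K)) (𝒜 : Finset (Set (Fin n → K)))
    (μ : Set (Fin n → K) → ℤ) : Prop :=
  μ V0 = 1 ∧
  ∀ Y ∈ interPoset K n V0 𝒜, Y ≠ V0 →
    ∑ Z ∈ (interPoset K n V0 𝒜).filter fun Z => Y ⊆ Z, μ Z = 0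

/-- The Poincaré polynomial `π(𝒜,t) = ∑_{X ∈ L(𝒜)} μ(X)(−t)^{codim X}`. -/
noncomputable def poin (V0 : Set (Fin n → K)) (𝒜 : Finset (Set (Fin n → K)))
    (μ : Set (Fin n → K) → ℤ) : Polynomial ℤ :=
  ∑ X ∈ interPoset K n V0 𝒜, Polynomial.C (μ X) * (- Polynomial.X) ^ codim K n V0 X

end Arrangement

section Cech
variable (K : Type) [Field K] (n : ℕ) (r : ℕ) (g : Fin r → MvPolynomial (Fin n) K)

/-- The `k`-th term of the Čech complex of localizations attached to the family
`g` of generators of an ideal: the product of the localizations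
`R[(∏_{i∈S} g_i)⁻¹]` over the `k`-element subsets `S` of the index set. -/
abbrev Cochain (k : ℕ) : Type :=
  ∀ S : {S : Finset (Fin r) // S.card = k}, Localization.Away (∏ i ∈ S.val, g i)

variable [∀ S : Finset (Fin r), Module (Weyl K n) (Localization.Away (∏ i ∈ S, g i))]

/-- The image of the previous Čech differential (`⊥` in degree `0`). -/
noncomputable def imPrev
    (d : ∀ k : ℕ, Cochain K n r g k →ₗ[Weyl K n] Cochain K n r g (k + 1)) :
    (i : ℕ) → Submodule (Weyl K n) (Cochain K n r g i)
  | 0 => ⊥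
  | (k + 1) => LinearMap.range (d k)

/-- `IsCechCoh g d i H π` : the left `D_n`-module `H`, equipped with the
`D_n`-epimorphism `π` from the kernel of the `i`-th Čech differential with
kernel the image of the `(i-1)`-st differential, is (a realization of) the
`i`-th Čech cohomology of the localizations of `R` at `g`, i.e. the local
cohomology module `H^i_{(g)}(R)` with its natural `D_n`-module structure. -/
def IsCechCoh (d : ∀ k : ℕ, Cochain K n r g k →ₗ[Weyl K n] Cochain K n r g (k + 1))
    (i : ℕ) (H : Type) [AddCommGroup H] [Module (Weyl K n) H]
    (π : LinearMap.ker (d i) →ₗ[Weyl K n] H) : Prop :=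
  Function.Surjective π ∧
    LinearMap.ker π =
      Submodule.comap (LinearMap.ker (d i)).subtype (imPrev K n r g d i)

/-- The Čech differential: the alternating sum of the canonical localization
maps `ψ`. -/
def IsCechDiff
    (ψ : ∀ S T : Finset (Fin r), S ⊆ T →
      (Localization.Away (∏ i ∈ S, g i) →ₐ[MvPolynomial (Fin n) K]
        Localization.Away (∏ i ∈ T, g i)))
    (d : ∀ k : ℕ, Cochain K n r g k →ₗ[Weyl K n] Cochain K n r g (k + 1)) :
    Prop :=
  ∀ (k : ℕ) (c : Cochain K n r g k) (T : {S : Finset (Fin r) // S.card = k + 1}),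
    d k c T = ∑ i ∈ T.val.attach,
      ((-1 : ℤ) ^ ((T.val.filter fun j => j < i.val).card)) •
        ψ (T.val.erase i.val) T.val (Finset.erase_subset _ _)
          (c ⟨T.val.erase i.val, by
            simp [Finset.card_erase_of_mem i.2, T.2]⟩)

end Cech

section CechSystem

variable {ι : Type*}

section Sign

variable [LinearOrder ι]

/-- The sign attached to the position of `i` in `T`. -/
def cechSign (i : ι) (T : Finset ι) : ℤ := (-1) ^ (T.filter fun j => j < i).card

lemma cechSign_mul_self (i : ι) (T : Finset ι) : cechSign i T * cechSign i T = 1 := by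
  unfold cechSign
  rw [← mul_pow]; simp

lemma cechSign_erase_of_lt {i j : ι} {T : Finset ι} (hi : i ∈ T) (hij : i < j) :
    cechSign j T = - cechSign j (T.erase i) := by
  unfold cechSign
  have h : (T.filter fun l => l < j) = insert i ((T.erase i).filter fun l => l < j) := by
    ext l
    simp only [Finset.mem_filter, Finset.mem_insert, Finset.mem_erase]
    constructor
    · rintro ⟨h1, h2⟩
      by_cases hl : l = i
      · exact Or.inl hl
      · exact Or.inr ⟨⟨hl, h1⟩, h2⟩
    · rintro (rfl | h)
      · exact ⟨hi, hij⟩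
      · exact ⟨h.1.2, h.2⟩
  rw [h, Finset.card_insert_of_notMem (by simp), pow_succ]
  ring

lemma cechSign_erase_of_not_lt {i j : ι} {T : Finset ι} (hij : ¬ i < j) :
    cechSign j (T.erase i) = cechSign j T := by
  unfold cechSign
  congr 2
  ext l
  simp only [Finset.mem_filter, Finset.mem_erase]
  constructor
  · rintro ⟨⟨_, h1⟩, h2⟩
    exact ⟨h1, h2⟩
  · rintro ⟨h1, h2⟩
    exact ⟨⟨fun h => hij (h ▸ h2), h1⟩, h2⟩

lemma cechSign_mul_erase {i j : ι} {T : Finset ι} (hi : i ∈ T) (hj : j ∈ T) (hij : i ≠ j) :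
    cechSign i T * cechSign j (T.erase i) = - (cechSign j T * cechSign i (T.erase j)) := by
  rcases lt_or_gt_of_ne hij with h | h
  · rw [cechSign_erase_of_lt hi h, cechSign_erase_of_not_lt (not_lt.2 h.le)]
    ring
  · rw [cechSign_erase_of_lt hj h, cechSign_erase_of_not_lt (not_lt.2 h.le)]
    ring

end Sign

variable {B : Type*} [CommRing B] (g : ι → B) (L : Finset ι → Type*)
  [∀ S, CommRing (L S)] [∀ S, Algebra B (L S)]
  [∀ S, IsLocalization.Away (∏ i ∈ S, g i) (L S)]

lemma isUnit_algebraMap_of_mem {S : Finset ι} {i : ι} (hi : i ∈ S) :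
    IsUnit (algebraMap B (L S) (g i)) :=
  IsLocalization.Away.isUnit_of_dvd (x := ∏ i ∈ S, g i) (Finset.dvd_prod_of_mem g hi)

lemma isUnit_algebraMap_prod {S T : Finset ι} (h : S ⊆ T) :
    IsUnit (algebraMap B (L T) (∏ i ∈ S, g i)) :=
  IsLocalization.Away.isUnit_of_dvd (x := ∏ i ∈ T, g i) (Finset.prod_dvd_prod_of_subset _ _ _ h)

/-- The canonical map between the localizations at `∏ i ∈ S, g i` and `∏ i ∈ T, g i`. -/
noncomputable def cechRes {S T : Finset ι} (h : S ⊆ T) : L S →ₐ[B] L T :=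
  IsLocalization.Away.liftAlgHom (A := B) (f := Algebra.ofId B (L T)) (∏ i ∈ S, g i)
    (isUnit_algebraMap_prod g L h)

include g in
lemma cechRes_unique {S : Finset ι} {P : Type*} [CommRing P] [Algebra B P]
    (f f' : L S →ₐ[B] P) : f = f' :=
  (IsLocalization.algHom_subsingleton (Submonoid.powers (∏ i ∈ S, g i))).elim f f'

lemma cechRes_cechRes {S T U : Finset ι} (h : S ⊆ T) (h' : T ⊆ U) (x : L S) :
    cechRes g L h' (cechRes g L h x) = cechRes g L (h.trans h') x :=
  DFunLike.congr_fun (cechRes_unique g L ((cechRes g L h').comp (cechRes g L h))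
    (cechRes g L (h.trans h'))) x

lemma cechRes_congr {S S' T : Finset ι} (e : S = S') (h : S ⊆ T) (h' : S' ⊆ T)
    (c : ∀ S, L S) : cechRes g L h (c S) = cechRes g L h' (c S') := by
  subst e; rfl

variable [LinearOrder ι]

/-- The Čech differential on families indexed by all finite subsets of `ι`. -/
noncomputable def cechD : (∀ S, L S) →ₗ[B] (∀ S, L S) where
  toFun c T := ∑ i ∈ T, cechSign i T • cechRes g L (T.erase_subset i) (c (T.erase i))
  map_add' c c' := by
    ext T
    simp [Finset.sum_add_distrib]
  map_smul' b c := by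
    ext T
    simp only [Pi.smul_apply, map_smul, RingHom.id_apply, Finset.smul_sum]
    exact Finset.sum_congr rfl fun i _ => smul_comm _ _ _

lemma cechD_apply (c : ∀ S, L S) (T : Finset ι) :
    cechD g L c T = ∑ i ∈ T, cechSign i T • cechRes g L (T.erase_subset i) (c (T.erase i)) := rfl

lemma cechD_congr {c c' : ∀ S, L S} {T : Finset ι} (h : ∀ i ∈ T, c (T.erase i) = c' (T.erase i)) :
    cechD g L c T = cechD g L c' T := by
  rw [cechD_apply, cechD_apply]
  exact Finset.sum_congr rfl fun i hi => by rw [h i hi]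

lemma cechRes_cechD (c : ∀ S, L S) {T U : Finset ι} (h : T ⊆ U) :
    cechRes g L h (cechD g L c T) =
      ∑ i ∈ T, cechSign i T • cechRes g L ((T.erase_subset i).trans h) (c (T.erase i)) := by
  rw [cechD_apply, map_sum]
  refine Finset.sum_congr rfl fun i _ => ?_
  rw [map_zsmul, cechRes_cechRes]

lemma cechD_cechD (c : ∀ S, L S) : cechD g L (cechD g L c) = 0 := by
  ext T
  rw [cechD_apply]
  simp only [cechRes_cechD, Finset.smul_sum]
  rw [Finset.sum_sigma']
  refine Finset.sum_involution (fun p _ => ⟨p.2, p.1⟩) ?_ ?_ ?_ ?_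
  · rintro ⟨i, j⟩ hp
    simp only [Finset.mem_sigma, Finset.mem_erase] at hp
    obtain ⟨hi, hji, hj⟩ := hp
    simp only [smul_smul]
    rw [cechSign_mul_erase hi hj (Ne.symm hji), cechRes_congr g L (Finset.erase_right_comm)
      _ (((T.erase j).erase_subset i).trans (T.erase_subset j)) c, neg_smul, neg_add_cancel]
  · rintro ⟨i, j⟩ hp _ h
    simp only [Finset.mem_sigma, Finset.mem_erase] at hp
    have := congrArg Sigma.fst h
    exact hp.2.1 this
  · rintro ⟨i, j⟩ hp
    simp only [Finset.mem_sigma, Finset.mem_erase] at hp ⊢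
    exact ⟨hp.2.2, Ne.symm hp.2.1, hp.1⟩
  · rintro ⟨i, j⟩ hp
    rfl

lemma exists_cechRes_insert_eq {S : Finset ι} {a : ι} (ha : a ∉ S) (y : L (insert a S)) :
    ∀ᶠ n : ℕ in Filter.atTop,
      ∃ x : L S, cechRes g L (Finset.subset_insert a S) x = g a ^ n • y := by
  obtain ⟨n, r, hr⟩ := IsLocalization.Away.surj (∏ i ∈ insert a S, g i) y
  refine Filter.eventually_atTop.2 ⟨n, fun m hm => ?_⟩
  obtain ⟨u, hu⟩ := (isUnit_algebraMap_prod g L (subset_refl S)).pow n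
  refine ⟨g a ^ (m - n) • (↑(u⁻¹) * algebraMap B (L S) r), ?_⟩
  have hu' : IsUnit (cechRes g L (Finset.subset_insert a S) (u : L S)) :=
    u.isUnit.map (cechRes g L (Finset.subset_insert a S))
  refine hu'.mul_left_cancel ?_
  rw [← map_mul, mul_smul_comm, Units.mul_inv_cancel_left, hu, map_smul, map_pow,
    AlgHom.commutes, AlgHom.commutes, ← hr, Finset.prod_insert ha]
  obtain ⟨k, rfl⟩ := Nat.exists_eq_add_of_le hm
  simp only [add_tsub_cancel_left, Algebra.smul_def, map_pow, map_mul]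
  ring

lemma exists_pow_smul_eq_zero_of_cechRes {S : Finset ι} {a : ι} (ha : a ∉ S) {x : L S}
    (hx : cechRes g L (Finset.subset_insert a S) x = 0) :
    ∀ᶠ n : ℕ in Filter.atTop, g a ^ n • x = 0 := by
  obtain ⟨n, r, hr⟩ := IsLocalization.Away.surj (∏ i ∈ S, g i) x
  have h0 : algebraMap B (L (insert a S)) r = 0 := by
    rw [← AlgHom.commutes (cechRes g L (Finset.subset_insert a S)), ← hr, map_mul, hx, zero_mul]
  rw [← map_zero (algebraMap B (L (insert a S)))] at h0
  obtain ⟨m, hm⟩ := IsLocalization.Away.exists_of_eq (∏ i ∈ insert a S, g i) h0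
  refine Filter.eventually_atTop.2 ⟨m, fun k hk => ?_⟩
  obtain ⟨l, rfl⟩ := Nat.exists_eq_add_of_le hk
  have hu := (isUnit_algebraMap_prod g L (subset_refl S)).pow (n + m)
  refine hu.mul_left_cancel ?_
  have h1 : algebraMap B (L S) (g a ^ m * (∏ i ∈ S, g i) ^ m * r) = 0 := by
    rw [← mul_pow, ← Finset.prod_insert ha, hm, mul_zero, map_zero]
  rw [map_mul, ← hr] at h1
  rw [mul_zero, Algebra.smul_def]
  calc _ = algebraMap B (L S) (g a) ^ l * (algebraMap B (L S) (g a ^ m * (∏ i ∈ S, g i) ^ m) *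
          (x * algebraMap B (L S) (∏ i ∈ S, g i) ^ n)) := by
        simp only [map_mul, map_pow]; ring
    _ = 0 := by rw [h1, mul_zero]

lemma exists_primitive_pow [Finite ι] (Q : Finset ι → Prop) (c : ∀ S, L S)
    (hc : ∀ S, ¬ Q S → c S = 0) (a : ι) (hQ : ∀ S, Q (insert a S) → Q S) :
    ∃ (N : ℕ) (b : ∀ S, L S), (∀ S, ¬ Q S → b S = 0) ∧
      ∀ T, (a ∉ T → cechD g L c (insert a T) = 0) → cechD g L b T = g a ^ N • c T := by
  classical
  have h1 : ∀ᶠ n : ℕ in Filter.atTop, ∀ S : Finset ι, a ∉ S →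
      ∃ x : L S, cechRes g L (Finset.subset_insert a S) x = g a ^ n • c (insert a S) := by
    refine Filter.eventually_all.2 fun S => ?_
    by_cases ha : a ∈ S
    · exact Filter.Eventually.of_forall fun n h => absurd ha h
    · exact (exists_cechRes_insert_eq g L ha _).mono fun n h _ => h
  obtain ⟨N, hN⟩ := h1.exists
  choose x hx using hN
  let b : ∀ S, L S := fun S =>
    if h : a ∉ S ∧ Q S then cechSign a (insert a S) • x S h.1 else 0
  have hbQ : ∀ S, ¬ Q S → b S = 0 := fun S h => dif_neg fun h' => h h'.2
  have hba : ∀ S, a ∈ S → b S = 0 := fun S h => dif_neg fun h' => h'.1 h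
  have hb : ∀ S T, ∀ h : S ⊆ T, a ∉ S → T = insert a S →
      cechRes g L h (b S) = cechSign a T • g a ^ N • c T := by
    rintro S T h ha rfl
    by_cases hS : Q S
    · rw [show b S = _ from dif_pos ⟨ha, hS⟩, map_zsmul, hx]
    · rw [hbQ S hS, hc _ fun h => hS (hQ S h)]
      simp
  have hmem : ∀ T, a ∈ T → cechD g L b T = g a ^ N • c T := by
    intro T ha
    rw [cechD_apply, Finset.sum_eq_single a]
    · rw [hb _ _ _ (Finset.notMem_erase a T) (Finset.insert_erase ha).symm, smul_smul,
        cechSign_mul_self, one_smul]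
    · intro i hi hia
      rw [hba _ (Finset.mem_erase.2 ⟨Ne.symm hia, ha⟩), map_zero, smul_zero]
    · exact fun h => absurd ha h
  have hnot : ∀ T, a ∉ T → cechD g L c (insert a T) = 0 →
      cechRes g L (Finset.subset_insert a T) (cechD g L b T - g a ^ N • c T) = 0 := by
    intro T ha hT
    have key : ∀ i ∈ T, cechSign i T • cechRes g L
          ((T.erase_subset i).trans (Finset.subset_insert a T)) (b (T.erase i)) =
        -(cechSign a (insert a T) • g a ^ N • cechSign i (insert a T) •
          cechRes g L (Finset.erase_subset i _) (c ((insert a T).erase i))) := by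
      intro i hi
      have hia : i ≠ a := fun h => ha (h ▸ hi)
      have e : (insert a T).erase i = insert a (T.erase i) :=
        Finset.erase_insert_of_ne (Ne.symm hia)
      have hs : T.erase i ⊆ (insert a T).erase i := by
        rw [e]; exact Finset.subset_insert _ _
      rw [← cechRes_cechRes g L hs (Finset.erase_subset i _),
        hb _ _ hs (fun h => ha (Finset.mem_of_mem_erase h)) e]
      have hsign := cechSign_mul_erase (Finset.mem_insert_of_mem (a := i) (b := a) hi)
        (Finset.mem_insert_self a T) hia
      rw [Finset.erase_insert ha] at hsign
      have hsign' : cechSign i T * cechSign a ((insert a T).erase i) =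
          -(cechSign a (insert a T) * cechSign i (insert a T)) := by
        have e1 := cechSign_mul_self i T
        have e2 := cechSign_mul_self i (insert a T)
        linear_combination cechSign i T * cechSign i (insert a T) * hsign
          - cechSign i T * cechSign a ((insert a T).erase i) * e2
          - cechSign a (insert a T) * cechSign i (insert a T) * e1
      rw [map_zsmul, smul_smul, hsign', map_smul, smul_comm (g a ^ N), smul_smul, neg_smul]
    rw [map_sub, cechRes_cechD, Finset.sum_congr rfl key, Finset.sum_neg_distrib,
      ← Finset.smul_sum, ← Finset.smul_sum]
    rw [cechD_apply, Finset.sum_insert ha, add_comm] at hT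
    rw [eq_neg_of_add_eq_zero_left hT, map_smul,
      cechRes_congr g L (Finset.erase_insert ha) _ (Finset.subset_insert a T), smul_neg, smul_neg,
      neg_neg, smul_comm (g a ^ N), smul_smul, cechSign_mul_self, one_smul, sub_self]
  have h2 : ∀ᶠ n : ℕ in Filter.atTop, ∀ T : Finset ι, a ∉ T → cechD g L c (insert a T) = 0 →
      g a ^ n • (cechD g L b T - g a ^ N • c T) = 0 := by
    refine Filter.eventually_all.2 fun T => ?_
    by_cases h : a ∉ T ∧ cechD g L c (insert a T) = 0
    · exact (exists_pow_smul_eq_zero_of_cechRes g L h.1 (hnot T h.1 h.2)).mono fun n h _ _ => h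
    · exact Filter.Eventually.of_forall fun n h1 h2 => absurd ⟨h1, h2⟩ h
  obtain ⟨M, hM⟩ := h2.exists
  refine ⟨M + N, g a ^ M • b, fun S hS => ?_, fun T hT => ?_⟩
  · rw [Pi.smul_apply, hbQ S hS, smul_zero]
  · rw [map_smul, Pi.smul_apply, pow_add, mul_smul]
    by_cases ha : a ∈ T
    · rw [hmem T ha]
    · exact sub_eq_zero.1 (by rw [← smul_sub]; exact hM T ha (hT ha))

/-- Cocycles in degree `k` of the Čech complex on the index set `U`. -/
def CechCocycle (U : Finset ι) (k : ℕ) (c : ∀ S, L S) : Prop :=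
  ∀ T ⊆ U, T.card = k + 1 → cechD g L c T = 0

lemma exists_primitive_of_mem_span [Finite ι] (Q : Finset ι → Prop) {U A : Finset ι} (hAU : A ⊆ U)
    {k : ℕ} {c : ∀ S, L S} (hc : ∀ S, ¬ Q S → c S = 0) (hcoc : CechCocycle g L U k c)
    (hQ : ∀ a ∈ A, ∀ S, Q (insert a S) → Q S) {t : B} (ht : t ∈ Ideal.span (g '' A)) :
    ∃ (N : ℕ) (b : ∀ S, L S), (∀ S, ¬ Q S → b S = 0) ∧
      ∀ T ⊆ U, T.card = k → cechD g L b T = t ^ N • c T := by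
  let J : Ideal B :=
    { carrier := {x | ∃ b : ∀ S, L S, (∀ S, ¬ Q S → b S = 0) ∧
        ∀ T ⊆ U, T.card = k → cechD g L b T = x • c T}
      zero_mem' := ⟨0, by simp, by simp⟩
      add_mem' := by
        rintro x y ⟨b, hb, hb'⟩ ⟨b₁, hb₁, hb₁'⟩
        refine ⟨b + b₁, fun S hS => by simp [hb S hS, hb₁ S hS], fun T hT hk => ?_⟩
        rw [map_add, Pi.add_apply, hb' T hT hk, hb₁' T hT hk, add_smul]
      smul_mem' := by
        rintro x y ⟨b, hb, hb'⟩
        refine ⟨x • b, fun S hS => by simp [hb S hS], fun T hT hk => ?_⟩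
        rw [map_smul, Pi.smul_apply, hb' T hT hk, smul_smul, smul_eq_mul] }
  have h : Ideal.span (g '' A) ≤ J.radical := by
    rw [Ideal.span_le]
    rintro _ ⟨a, ha, rfl⟩
    obtain ⟨N, b, hb, hb'⟩ := exists_primitive_pow g L Q c hc a (hQ a ha)
    refine ⟨N, b, hb, fun T hT hk => hb' T fun haT => hcoc _ ?_ ?_⟩
    · exact Finset.insert_subset (hAU ha) hT
    · rw [Finset.card_insert_of_notMem haT, hk]
  obtain ⟨N, b, hb⟩ := h ht
  exact ⟨N, b, hb⟩

lemma exists_primitive_of_support [Finite ι] {A : Finset ι} {j : ι} (hjA : j ∉ A) {k : ℕ}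
    {c : ∀ S, L S} (hc : ∀ S, j ∉ S → c S = 0) (hcoc : CechCocycle g L (insert j A) k c)
    (hj : g j ∈ Ideal.span (g '' A)) :
    ∃ b : ∀ S, L S, (∀ S, j ∉ S → b S = 0) ∧
      ∀ T ⊆ insert j A, T.card = k → cechD g L b T = c T := by
  classical
  obtain ⟨N, b, hb, hb'⟩ := exists_primitive_of_mem_span g L (fun S => j ∈ S)
    (Finset.subset_insert j A) hc hcoc (fun a ha S h => by
      rcases Finset.mem_insert.1 h with h | h
      · exact absurd (h ▸ ha) hjA
      · exact h) hj
  have hdiv : ∀ S, ∃ y : L S, g j ^ N • y = b S := by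
    intro S
    by_cases hS : j ∈ S
    · obtain ⟨u, hu⟩ := (isUnit_algebraMap_of_mem g L hS).pow N
      exact ⟨↑(u⁻¹) * b S, by rw [Algebra.smul_def, map_pow, ← hu, Units.mul_inv_cancel_left]⟩
    · exact ⟨0, by rw [hb S hS, smul_zero]⟩
  choose y hy using hdiv
  let b₁ : ∀ S, L S := fun S => if j ∈ S then y S else 0
  have hb₁ : g j ^ N • b₁ = b := by
    ext S
    by_cases hS : j ∈ S
    · simp only [Pi.smul_apply, b₁, if_pos hS, hy]
    · simp only [Pi.smul_apply, b₁, if_neg hS, smul_zero, hb S hS]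
  refine ⟨b₁, fun S hS => if_neg hS, fun T hT hk => ?_⟩
  by_cases hjT : j ∈ T
  · have h := hb' T hT hk
    rw [← hb₁, map_smul, Pi.smul_apply, Algebra.smul_def, Algebra.smul_def, map_pow] at h
    exact ((isUnit_algebraMap_of_mem g L hjT).pow N).mul_left_cancel h
  · rw [hc T hjT, cechD_apply]
    refine Finset.sum_eq_zero fun i _ => ?_
    rw [show b₁ (T.erase i) = 0 from if_neg fun h => hjT (Finset.mem_of_mem_erase h), map_zero,
      smul_zero]

/-- Restriction of Čech cochains from the index set `U` to `A` induces bijections on cohomology. -/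
structure CechQuasiIso (A U : Finset ι) : Prop where
  lift : ∀ k c, CechCocycle g L A k c →
    ∃ c', CechCocycle g L U k c' ∧ ∀ S ⊆ A, S.card = k → c' S = c S
  primitive : ∀ k c b, CechCocycle g L U k c → (∀ S ⊆ A, S.card = k → c S = cechD g L b S) →
    ∃ b', ∀ S ⊆ U, S.card = k → c S = cechD g L b' S

lemma cechQuasiIso_insert [Finite ι] {A : Finset ι} {j : ι} (hjA : j ∉ A)
    (hj : g j ∈ Ideal.span (g '' A)) : CechQuasiIso g L A (insert j A) where
  lift k c hc := by
    let c₀ : ∀ S, L S := fun S => if j ∈ S then 0 else c S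
    have hc₀ : ∀ S, j ∉ S → c₀ S = c S := fun S h => if_neg h
    let e : ∀ S, L S := fun S => if j ∈ S then cechD g L c₀ S else 0
    have he : ∀ T ⊆ insert j A, T.card = k + 1 → e T = cechD g L c₀ T := by
      intro T hT hk
      by_cases hjT : j ∈ T
      · exact if_pos hjT
      · rw [show e T = 0 from if_neg hjT,
          cechD_congr g L fun i _ => hc₀ _ fun h => hjT (Finset.mem_of_mem_erase h),
          hc T ((Finset.subset_insert_iff_of_notMem hjT).1 hT) hk]
    obtain ⟨b, hb₀, hb⟩ := exists_primitive_of_support g L hjA (k := k + 1) (c := e)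
      (fun S h => if_neg h) (fun T hT hk => by
        rw [cechD_congr g L fun i hi => he (T.erase i) ((T.erase_subset i).trans hT)
          (by rw [Finset.card_erase_of_mem hi, hk]; rfl), cechD_cechD]
        rfl) hj
    refine ⟨c₀ - b, fun T hT hk => ?_, fun S hS _ => ?_⟩
    · rw [map_sub, Pi.sub_apply, hb T hT hk, he T hT hk, sub_self]
    · have h : j ∉ S := fun h => hjA (hS h)
      rw [Pi.sub_apply, hc₀ S h, hb₀ S h, sub_zero]
  primitive k c b hc hb := by
    let c₁ : ∀ S, L S := fun S => if j ∈ S then c S - cechD g L b S else 0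
    have hc₁ : ∀ S ⊆ insert j A, S.card = k → c₁ S = c S - cechD g L b S := by
      intro S hS hk
      by_cases hjS : j ∈ S
      · exact if_pos hjS
      · rw [show c₁ S = 0 from if_neg hjS,
          hb S ((Finset.subset_insert_iff_of_notMem hjS).1 hS) hk, sub_self]
    obtain ⟨b', -, hb'⟩ := exists_primitive_of_support g L hjA (k := k) (c := c₁)
      (fun S h => if_neg h) (fun T hT hk => by
        rw [cechD_congr g L (c' := c - cechD g L b) fun i hi => hc₁ (T.erase i)
          ((T.erase_subset i).trans hT) (by rw [Finset.card_erase_of_mem hi, hk]; rfl),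
          map_sub, cechD_cechD, sub_zero, hc T hT hk]) hj
    refine ⟨b + b', fun S hS hk => ?_⟩
    rw [map_add, Pi.add_apply, hb' S hS hk, hc₁ S hS hk]
    abel

lemma CechQuasiIso.trans {A U W : Finset ι} (hAU : A ⊆ U) (hUW : U ⊆ W)
    (h : CechQuasiIso g L A U) (h' : CechQuasiIso g L U W) : CechQuasiIso g L A W where
  lift k c hc := by
    obtain ⟨c₁, hc₁, e₁⟩ := h.lift k c hc
    obtain ⟨c₂, hc₂, e₂⟩ := h'.lift k c₁ hc₁
    exact ⟨c₂, hc₂, fun S hS hk => (e₂ S (hS.trans hAU) hk).trans (e₁ S hS hk)⟩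
  primitive k c b hc hb := by
    obtain ⟨b', hb'⟩ := h.primitive k c b (fun T hT => hc T (hT.trans hUW)) hb
    exact h'.primitive k c b' hc hb'

lemma cechQuasiIso_refl (A : Finset ι) : CechQuasiIso g L A A where
  lift _ c hc := ⟨c, hc, fun _ _ _ => rfl⟩
  primitive _ _ b _ hb := ⟨b, hb⟩

lemma cechQuasiIso_union [Finite ι] {A V : Finset ι}
    (hV : ∀ j ∈ V, g j ∈ Ideal.span (g '' A)) : CechQuasiIso g L A (A ∪ V) := by
  induction V using Finset.induction_on with
  | empty => simpa using cechQuasiIso_refl g L A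
  | insert j V hj ih =>
    have ih := ih fun i hi => hV i (Finset.mem_insert_of_mem hi)
    rw [Finset.union_insert]
    by_cases hjV : j ∈ A ∪ V
    · rwa [Finset.insert_eq_of_mem hjV]
    · refine ih.trans g L Finset.subset_union_left (Finset.subset_insert _ _)
        (cechQuasiIso_insert g L hjV ?_)
      exact Ideal.span_mono (Set.image_mono (by simp)) (hV j (Finset.mem_insert_self j V))

lemma cechQuasiIso_univ [Fintype ι] {A : Finset ι}
    (hA : ∀ j, g j ∈ Ideal.span (g '' A)) : CechQuasiIso g L A Finset.univ := by
  have h := cechQuasiIso_union g L (A := A) (V := Finset.univ) fun j _ => hA j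
  rwa [Finset.union_eq_right.2 (Finset.subset_univ A)] at h

end CechSystem

section CechCohomology

lemma exists_extend_of_injective {α β : Type*} {e : α → β} (he : Function.Injective e)
    {L : β → Type*} [∀ b, Zero (L b)] (m : ∀ a, L (e a)) :
    ∃ c : ∀ b, L b, ∀ a, c (e a) = m a := by
  classical
  refine ⟨fun b => if h : ∃ a, e a = b then h.choose_spec ▸ m h.choose else 0, fun a => ?_⟩
  have h : ∃ a', e a' = e a := ⟨a, rfl⟩
  refine (dif_pos h).trans ?_
  have : ∀ a' (h : e a' = e a), h ▸ m a' = m a := by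
    intro a' h
    obtain rfl := he h
    rfl
  exact this _ _

variable {ι : Type*} {B : Type*} [CommRing B] (D : Type*) [Ring D] (g : ι → B)
  (L : Finset ι → Type*) [∀ S, CommRing (L S)] [∀ S, Algebra B (L S)]
  [∀ S, IsLocalization.Away (∏ i ∈ S, g i) (L S)] [∀ S, Module D (L S)]

/-- The ring `D` acts compatibly with the canonical maps between the localizations. -/
def CechLinear : Prop :=
  ∀ (S T : Finset ι) (h : S ⊆ T) (a : D) (x : L S), cechRes g L h (a • x) = a • cechRes g L h x

variable [LinearOrder ι]

variable {D g L} in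
lemma CechLinear.cechD_smul (hD : CechLinear D g L) (a : D) (c : ∀ S, L S) :
    cechD g L (a • c) = a • cechD g L c := by
  ext T
  rw [Pi.smul_apply, cechD_apply, cechD_apply, Finset.smul_sum]
  refine Finset.sum_congr rfl fun i _ => ?_
  rw [Pi.smul_apply, hD, smul_comm]

variable [Fintype ι]

variable {D g L} in
/-- The `D`-module of Čech cocycles of degree `k`. -/
def CechLinear.cocycles (hD : CechLinear D g L) (k : ℕ) : Submodule D (∀ S, L S) where
  carrier := {c | CechCocycle g L Finset.univ k c}
  zero_mem' := fun T _ _ => by rw [map_zero]; rfl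
  add_mem' := fun {a b} ha hb T hT hk => by
    rw [map_add, Pi.add_apply, ha T hT hk, hb T hT hk, add_zero]
  smul_mem' := fun a c hc T hT hk => by
    rw [hD.cechD_smul, Pi.smul_apply, hc T hT hk, smul_zero]

/-- A `D`-module realizing the degree `k` Čech cohomology of the system `L`. -/
structure CechCohomology (hD : CechLinear D g L) (k : ℕ) (H : Type*) [AddCommGroup H]
    [Module D H] where
  /-- The projection from cocycles to cohomology. -/
  proj : hD.cocycles k →ₗ[D] H
  surjective : Function.Surjective proj
  proj_eq_zero_iff : ∀ c, proj c = 0 ↔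
    ∃ b : ∀ S, L S, ∀ S : Finset ι, S.card = k → c.1 S = cechD g L b S

lemma nonempty_linearEquiv_of_ker_eq {M N N' : Type*} [AddCommGroup M] [Module D M]
    [AddCommGroup N] [Module D N] [AddCommGroup N'] [Module D N']
    (f : M →ₗ[D] N) (f' : M →ₗ[D] N') (hf : Function.Surjective f)
    (hf' : Function.Surjective f') (h : ∀ x, f x = 0 ↔ f' x = 0) : Nonempty (N ≃ₗ[D] N') :=
  have h' : LinearMap.ker f = LinearMap.ker f' := by
    ext x
    exact h x
  ⟨(f.quotKerEquivOfSurjective hf).symm.trans ((Submodule.quotEquivOfEq _ _ h').trans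
    (f'.quotKerEquivOfSurjective hf'))⟩

variable {D g L} in
lemma CechCohomology.nonempty_linearEquiv {hD : CechLinear D g L} {k : ℕ} {H H' : Type*}
    [AddCommGroup H] [Module D H] [AddCommGroup H'] [Module D H']
    (h : CechCohomology D g L hD k H) (h' : CechCohomology D g L hD k H') :
    Nonempty (H ≃ₗ[D] H') :=
  nonempty_linearEquiv_of_ker_eq D h.proj h'.proj h.surjective h'.surjective fun c =>
    (h.proj_eq_zero_iff c).trans (h'.proj_eq_zero_iff c).symm

section Restrict

variable {κ : Type*} [LinearOrder κ] [Fintype κ] (g' : κ → B)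
  (M : Finset κ → Type*) [∀ S, CommRing (M S)] [∀ S, Algebra B (M S)]
  [∀ S, IsLocalization.Away (∏ i ∈ S, g' i) (M S)] [∀ S, Module D (M S)]
  (j : κ ↪o ι)

omit [Fintype ι] [Fintype κ] in
lemma cechSign_map (i : κ) (T : Finset κ) :
    cechSign (j i) (T.map j.toEmbedding) = cechSign i T := by
  unfold cechSign
  rw [Finset.filter_map, Finset.card_map]
  congr 3
  ext l
  simp

variable (f : ∀ S, L (S.map j.toEmbedding) →ₐ[B] M S)

omit [Fintype ι] [Fintype κ] in
lemma cechD_restrict (c : ∀ S, L S) (T : Finset κ) :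
    cechD g' M (fun S => f S (c (S.map j.toEmbedding))) T =
      f T (cechD g L c (T.map j.toEmbedding)) := by
  rw [cechD_apply, cechD_apply, Finset.sum_map, map_sum]
  refine Finset.sum_congr rfl fun i _ => ?_
  have e : (T.erase i).map j.toEmbedding = (T.map j.toEmbedding).erase (j i) :=
    Finset.map_erase _ _ _
  have hs : (T.erase i).map j.toEmbedding ⊆ T.map j.toEmbedding :=
    Finset.map_subset_map.2 (T.erase_subset i)
  rw [map_zsmul]
  change _ = cechSign (j i) _ • f T (cechRes g L _ (c ((T.map j.toEmbedding).erase (j i))))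
  rw [cechSign_map, ← cechRes_congr g L e hs]
  congr 1
  exact DFunLike.congr_fun (cechRes_unique g L
    ((cechRes g' M (T.erase_subset i)).comp (f (T.erase i))) ((f T).comp (cechRes g L hs))) _

variable {D g L g' M} in
/-- Čech cohomology can be computed from any larger family in the same ideal. -/
lemma CechCohomology.nonempty_of_restrict {hL : CechLinear D g L} {hM : CechLinear D g' M}
    (hf : ∀ S, Function.Bijective (f S)) (hfD : ∀ S (a : D) x, f S (a • x) = a • f S x)
    (hg : ∀ i, g i ∈ Ideal.span (Set.range fun l => g (j l)))
    {k : ℕ} {H : Type*} [AddCommGroup H] [Module D H] (h : CechCohomology D g' M hM k H) :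
    Nonempty (CechCohomology D g L hL k H) := by
  have hq : CechQuasiIso g L (Finset.univ.map j.toEmbedding) Finset.univ := by
    refine cechQuasiIso_univ g L fun i => ?_
    have e : g '' (Finset.univ.map j.toEmbedding : Finset ι) = Set.range fun l => g (j l) := by
      rw [Finset.coe_map, Finset.coe_univ, Set.image_univ, ← Set.range_comp]
      rfl
    rw [e]
    exact hg i
  let ρ : (∀ S, L S) →ₗ[D] (∀ S, M S) :=
    { toFun := fun c S => f S (c (S.map j.toEmbedding))
      map_add' := fun c c' => by ext S; simp
      map_smul' := fun a c => by ext S; simp [hfD] }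
  have hρd : ∀ c T, cechD g' M (ρ c) T = f T (cechD g L c (T.map j.toEmbedding)) :=
    cechD_restrict g L g' M j f
  have hρ : Function.Surjective ρ := by
    intro m
    choose y hy using fun S => (hf S).2 (m S)
    obtain ⟨c, hc⟩ := exists_extend_of_injective (Finset.map_injective j.toEmbedding) y
    exact ⟨c, funext fun S => by change f S (c _) = _; rw [hc, hy]⟩
  have hsub : ∀ S : Finset ι, S ⊆ Finset.univ.map j.toEmbedding →
      ∃ S' : Finset κ, S = S'.map j.toEmbedding := by
    intro S hS
    obtain ⟨S', -, e⟩ := Finset.subset_map_iff.1 hS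
    exact ⟨S', e⟩
  have hcoc : ∀ c, CechCocycle g L Finset.univ k c → CechCocycle g' M Finset.univ k (ρ c) :=
    fun c hc T _ hk => by
      rw [hρd, hc _ (Finset.subset_univ _) (by rw [Finset.card_map, hk]), map_zero]
  refine ⟨⟨h.proj.comp ((ρ.domRestrict (hL.cocycles k)).codRestrict (hM.cocycles k)
    fun c => hcoc c c.2), fun x => ?_, fun c => ?_⟩⟩
  · obtain ⟨⟨m, hm⟩, rfl⟩ := h.surjective x
    obtain ⟨c, rfl⟩ := hρ m
    obtain ⟨c', hc', e⟩ := hq.lift k c fun T hT hk => by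
      obtain ⟨T, rfl⟩ := hsub T hT
      have := hm T (Finset.subset_univ _) (by rwa [Finset.card_map] at hk)
      rw [hρd] at this
      exact (hf T).1 (this.trans (map_zero _).symm)
    refine ⟨⟨c', hc'⟩, ?_⟩
    rw [← sub_eq_zero, LinearMap.comp_apply, ← map_sub, h.proj_eq_zero_iff]
    refine ⟨0, fun S hk => ?_⟩
    rw [map_zero]
    change f S (c' _) - f S (c _) = 0
    rw [e _ (Finset.map_subset_map.2 (Finset.subset_univ S)) (by rw [Finset.card_map, hk]),
      sub_self]
  · rw [LinearMap.comp_apply, h.proj_eq_zero_iff]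
    constructor
    · rintro ⟨b, hb⟩
      obtain ⟨b, rfl⟩ := hρ b
      obtain ⟨b', hb'⟩ := hq.primitive k c.1 b c.2 fun S hS hk => by
        obtain ⟨S, rfl⟩ := hsub S hS
        have := hb S (by rwa [Finset.card_map] at hk)
        rw [hρd] at this
        exact (hf S).1 this
      exact ⟨b', fun S => hb' S (Finset.subset_univ S)⟩
    · rintro ⟨b, hb⟩
      refine ⟨ρ b, fun S hk => ?_⟩
      rw [hρd, ← hb _ (by rw [Finset.card_map, hk])]
      rfl

end Restrict

end CechCohomology

section DerActs

/-- Two additive maps on a localization satisfying the Leibniz rule along a ring homomorphism `f`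
agree as soon as they agree on the base ring. -/
lemma eq_of_leibniz {B L P : Type*} [CommRing B] [CommRing L] [CommRing P] [Algebra B L]
    (M : Submonoid B) [IsLocalization M L] (f : L →+* P) (d d' : L → P)
    (hd : ∀ x y, d (x * y) = f x * d y + f y * d x)
    (hd' : ∀ x y, d' (x * y) = f x * d' y + f y * d' x)
    (h : ∀ b, d (algebraMap B L b) = d' (algebraMap B L b)) (x : L) : d x = d' x := by
  obtain ⟨⟨b, s⟩, hs⟩ := IsLocalization.surj M x
  have hu : IsUnit (f (algebraMap B L s)) := (IsLocalization.map_units L s).map f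
  have e : d (x * algebraMap B L s) = d' (x * algebraMap B L s) := by
    rw [hs]
    exact h b
  rw [hd, hd', h] at e
  exact hu.mul_left_cancel (add_left_cancel e)

variable {K : Type*} [Field K] {I J : Type*}

variable (K) in
/-- The free algebra on `I ⊕ J` acts on the `B`-algebra `L`, the generators in `I` by
multiplication with elements `x i` of `B` and the generators in `J` by derivations extending the
operators `η j` on `B`. -/
structure DerActs {B : Type*} [CommRing B] [Algebra K B] (x : I → B) (η : J → B → B)
    (L : Type*) [CommRing L] [Algebra B L] [Module (FreeAlgebra K (I ⊕ J)) L] : Prop where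
  algebraMap_smul : ∀ (c : K) (m : L), algebraMap K (FreeAlgebra K (I ⊕ J)) c • m =
    algebraMap B L (algebraMap K B c) * m
  inl_smul : ∀ (i : I) (m : L), FreeAlgebra.ι K (Sum.inl i : I ⊕ J) • m =
    algebraMap B L (x i) * m
  inr_smul_mul : ∀ (j : J) (m m' : L), FreeAlgebra.ι K (Sum.inr j : I ⊕ J) • (m * m') =
    m * FreeAlgebra.ι K (Sum.inr j : I ⊕ J) • m' + m' * FreeAlgebra.ι K (Sum.inr j : I ⊕ J) • m
  inr_smul_algebraMap : ∀ (j : J) (b : B), FreeAlgebra.ι K (Sum.inr j : I ⊕ J) • algebraMap B L b =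
    algebraMap B L (η j b)

/-- Ring homomorphisms between localizations are compatible with such actions as soon as this
holds on the base rings. -/
lemma DerActs.map_smul {B B' : Type*} [CommRing B] [Algebra K B] [CommRing B'] [Algebra K B']
    {x : I → B} {η : J → B → B} {x' : I → B'} {η' : J → B' → B'}
    {L P : Type*} [CommRing L] [CommRing P] [Algebra B L] [Algebra B' P]
    [Module (FreeAlgebra K (I ⊕ J)) L] [Module (FreeAlgebra K (I ⊕ J)) P]
    (hL : DerActs K x η L) (hP : DerActs K x' η' P) (M : Submonoid B) [IsLocalization M L]
    (φ : B →ₐ[K] B') (hx : ∀ i, φ (x i) = x' i) (hη : ∀ j b, φ (η j b) = η' j (φ b))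
    (f : L →+* P) (hf : ∀ b, f (algebraMap B L b) = algebraMap B' P (φ b))
    (a : FreeAlgebra K (I ⊕ J)) (m : L) : f (a • m) = a • f m := by
  induction a using FreeAlgebra.induction generalizing m with
  | grade0 c => rw [hL.algebraMap_smul, hP.algebraMap_smul, map_mul, hf, AlgHom.commutes]
  | grade1 i =>
    rcases i with i | j
    · rw [hL.inl_smul, hP.inl_smul, map_mul, hf, hx]
    · refine eq_of_leibniz M f (fun m => f (FreeAlgebra.ι K (Sum.inr j : I ⊕ J) • m))
        (fun m => FreeAlgebra.ι K (Sum.inr j : I ⊕ J) • f m) (fun m m' => ?_) (fun m m' => ?_)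
        (fun b => ?_) m
      · simp only [hL.inr_smul_mul, map_add, map_mul]
      · simp only [map_mul, hP.inr_smul_mul]
      · simp only [hL.inr_smul_algebraMap, hf, hη, hP.inr_smul_algebraMap]
  | mul a b ha hb => rw [mul_smul, ha, hb, mul_smul]
  | add a b ha hb => rw [add_smul, map_add, ha, hb, add_smul]

lemma DerActs.cechLinear {B ι : Type*} [CommRing B] [Algebra K B] {x : I → B} {η : J → B → B}
    {g : ι → B} {L : Finset ι → Type*} [∀ S, CommRing (L S)] [∀ S, Algebra B (L S)]
    [∀ S, IsLocalization.Away (∏ i ∈ S, g i) (L S)]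
    [∀ S, Module (FreeAlgebra K (I ⊕ J)) (L S)] (h : ∀ S, DerActs K x η (L S)) :
    CechLinear (FreeAlgebra K (I ⊕ J)) g L := fun S T hST a m =>
  (h S).map_smul (h T) (Submonoid.powers (∏ i ∈ S, g i)) (AlgHom.id K B) (fun _ => rfl)
    (fun _ _ => rfl) (cechRes g L hST : L S →+* L T) (fun b => (cechRes g L hST).commutes b) a m

/-- Derivations extend to localizations. -/
lemma exists_derivation_extend {B L : Type*} [CommRing B] [Algebra K B] [CommRing L] [Algebra B L]
    [Algebra K L] [IsScalarTower K B L] (M : Submonoid B) [IsLocalization M L]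
    (η : Derivation K B B) :
    ∃ δ : Derivation K L L, ∀ b, δ (algebraMap B L b) = algebraMap B L (η b) := by
  have : Algebra.FormallyEtale B L := Algebra.FormallyEtale.of_isLocalization M
  let η' : Derivation K B L := (Algebra.linearMap B L).compDer η
  let l : TensorProduct B L (Ω[B⁄K]) →ₗ[L] L :=
    LinearMap.liftBaseChange L η'.liftKaehlerDifferential
  let e := KaehlerDifferential.tensorKaehlerEquivOfFormallyEtale K B L
  refine ⟨(l.comp (e.symm : Ω[L⁄K] →ₗ[L] _)).compDer (KaehlerDifferential.D K L), fun b => ?_⟩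
  change l (e.symm (KaehlerDifferential.D K L (algebraMap B L b))) = _
  rw [KaehlerDifferential.tensorKaehlerEquivOfFormallyEtale_symm_D_algebraMap]
  simp [l, η']

lemma exists_derActs {B : Type*} [CommRing B] [Algebra K B] (x : I → B)
    (η : J → Derivation K B B) (L : Type*) [CommRing L] [Algebra B L] [Algebra K L]
    [IsScalarTower K B L] (M : Submonoid B) [IsLocalization M L] :
    ∃ _ : Module (FreeAlgebra K (I ⊕ J)) L, DerActs K x (fun j => η j) L := by
  choose δ hδ using fun j => exists_derivation_extend (L := L) M (η j)
  let ρ : I ⊕ J → Module.End K L :=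
    Sum.elim (fun i => LinearMap.mulLeft K (algebraMap B L (x i))) fun j => (δ j : L →ₗ[K] L)
  refine ⟨Module.compHom L (FreeAlgebra.lift K ρ).toRingHom, ?_⟩
  let _ : Module (FreeAlgebra K (I ⊕ J)) L := Module.compHom L (FreeAlgebra.lift K ρ).toRingHom
  have hs : ∀ (a : FreeAlgebra K (I ⊕ J)) (m : L), a • m = FreeAlgebra.lift K ρ a m :=
    fun _ _ => rfl
  refine ⟨fun c m => ?_, fun i m => ?_, fun j m m' => ?_, fun j b => ?_⟩
  · rw [hs, AlgHom.commutes, Module.algebraMap_end_apply, Algebra.smul_def,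
      IsScalarTower.algebraMap_apply K B L]
  · rw [hs, FreeAlgebra.lift_ι_apply]
    rfl
  · rw [hs, hs, hs, FreeAlgebra.lift_ι_apply]
    exact (δ j).leibniz m m'
  · rw [hs, FreeAlgebra.lift_ι_apply]
    exact hδ j b

end DerActs

section WeylAlgebra

variable {K : Type} [Field K] {n : ℕ}

lemma weyl_mkAlgHom_surjective : Function.Surjective (RingQuot.mkAlgHom K (WeylRel K n)) :=
  RingQuot.mkAlgHom_surjective K _

lemma wX_mul_wX (i j : Fin n) : wX K n i * wX K n j = wX K n j * wX K n i := by
  simpa [wX] using RingQuot.mkAlgHom_rel K (WeylRel.xx (K := K) i j)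

lemma wD_mul_wD (i j : Fin n) : wD K n i * wD K n j = wD K n j * wD K n i := by
  simpa [wD] using RingQuot.mkAlgHom_rel K (WeylRel.dd (K := K) i j)

lemma wD_mul_wX (i j : Fin n) :
    wD K n i * wX K n j = wX K n j * wD K n i + if i = j then 1 else 0 := by
  have := RingQuot.mkAlgHom_rel K (WeylRel.dx (K := K) i j)
  rw [map_mul, map_add, map_mul] at this
  rw [wD, wX, this]
  split_ifs <;> simp

lemma weyl_adjoin : Algebra.adjoin K (Set.range (wX K n) ∪ Set.range (wD K n)) = ⊤ := by
  have h := congrArg (Subalgebra.map (RingQuot.mkAlgHom K (WeylRel K n)))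
    (FreeAlgebra.adjoin_range_ι K (Fin n ⊕ Fin n))
  rw [AlgHom.map_adjoin, Algebra.map_top,
    (AlgHom.range_eq_top _).2 weyl_mkAlgHom_surjective, ← Set.range_comp,
    Sum.range_eq] at h
  exact h

end WeylAlgebra

section NatActs

variable {K : Type} [Field K] {n : ℕ} {f : MvPolynomial (Fin n) K}
  [Module (Weyl K n) (Localization.Away f)] [IsScalarTower K (Weyl K n) (Localization.Away f)]

lemma weyl_algebraMap_smul (c : K) (m : Localization.Away f) :
    algebraMap K (Weyl K n) c • m = algebraMap (MvPolynomial (Fin n) K) (Localization.Away f)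
      (algebraMap K (MvPolynomial (Fin n) K) c) * m := by
  rw [algebraMap_smul, ← IsScalarTower.algebraMap_apply, Algebra.smul_def]

omit [IsScalarTower K (Weyl K n) (Localization.Away f)] in
lemma NatActs.wD_smul_mul (h : NatActs K n f) (i : Fin n) (m m' : Localization.Away f) :
    wD K n i • (m * m') = m * wD K n i • m' + m' * wD K n i • m := by
  obtain ⟨δ, hδ, -⟩ := h.2 i
  rw [hδ, hδ, hδ]
  exact δ.leibniz m m'

omit [IsScalarTower K (Weyl K n) (Localization.Away f)] in
lemma NatActs.wD_smul_algebraMap (h : NatActs K n f) (i : Fin n) (b : MvPolynomial (Fin n) K) :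
    wD K n i • algebraMap (MvPolynomial (Fin n) K) (Localization.Away f) b =
      algebraMap (MvPolynomial (Fin n) K) (Localization.Away f) (MvPolynomial.pderiv i b) := by
  obtain ⟨δ, hδ, h'⟩ := h.2 i
  rw [hδ, h']

end NatActs

section Realization

variable {ι B : Type*} [CommRing B] {D D' : Type*} [Ring D] [Ring D'] {g : ι → B}
  {L : Finset ι → Type*} [∀ S, CommRing (L S)] [∀ S, Algebra B (L S)]
  [∀ S, IsLocalization.Away (∏ i ∈ S, g i) (L S)] [∀ S, Module D (L S)] [∀ S, Module D' (L S)]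

variable (g L) in
omit [∀ S, Module D (L S)] [∀ S, Module D' (L S)] in
lemma cechD_of_card_eq_zero [LinearOrder ι] (c : ∀ S, L S) {S : Finset ι} (hS : S.card = 0) :
    cechD g L c S = 0 := by
  obtain rfl := Finset.card_eq_zero.1 hS
  rw [cechD_apply, Finset.sum_empty]

lemma CechLinear.of_surjective (h : CechLinear D' g L) (θ : D' →+* D)
    (hs : Function.Surjective θ) (hθ : ∀ S a (x : L S), a • x = θ a • x) :
    CechLinear D g L := fun S T hST a x => by
  obtain ⟨a, rfl⟩ := hs a
  rw [← hθ, ← hθ, h]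

/-- Restriction of scalars for Čech cohomology modules. -/
def CechCohomology.compHom [LinearOrder ι] [Fintype ι] {h : CechLinear D g L} {k : ℕ} {H : Type*}
    [AddCommGroup H] [Module D H] [Module D' H] (hH : CechCohomology D g L h k H)
    (h' : CechLinear D' g L) (θ : D' →+* D) (hθ : ∀ S a (x : L S), a • x = θ a • x)
    (hθH : ∀ a (x : H), a • x = θ a • x) : CechCohomology D' g L h' k H where
  proj :=
    { toFun := fun c => hH.proj ⟨c.1, c.2⟩
      map_add' := fun c c' => hH.proj.map_add ⟨c.1, c.2⟩ ⟨c'.1, c'.2⟩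
      map_smul' := fun a c => by
        rw [RingHom.id_apply, hθH, ← hH.proj.map_smul]
        congr 1
        ext S
        exact hθ S a (c.1 S) }
  surjective x := by
    obtain ⟨c, rfl⟩ := hH.surjective x
    exact ⟨⟨c.1, c.2⟩, rfl⟩
  proj_eq_zero_iff c := hH.proj_eq_zero_iff ⟨c.1, c.2⟩

end Realization

section WeylRealization

variable {K : Type} [Field K] {n r : ℕ} {g : Fin r → MvPolynomial (Fin n) K}
  [∀ S : Finset (Fin r), Module (Weyl K n) (Localization.Away (∏ i ∈ S, g i))]

lemma NatActs.cechLinear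
    [∀ S : Finset (Fin r), IsScalarTower K (Weyl K n) (Localization.Away (∏ i ∈ S, g i))]
    (hnat : ∀ S : Finset (Fin r), NatActs K n (∏ i ∈ S, g i)) :
    CechLinear (Weyl K n) g fun S => Localization.Away (∏ i ∈ S, g i) := by
  let θ := RingQuot.mkAlgHom K (WeylRel K n)
  let _ (S : Finset (Fin r)) : Module (FreeAlgebra K (Fin n ⊕ Fin n))
      (Localization.Away (∏ i ∈ S, g i)) := Module.compHom _ θ.toRingHom
  have hs : ∀ (S : Finset (Fin r)) (a : FreeAlgebra K (Fin n ⊕ Fin n))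
    (m : Localization.Away (∏ i ∈ S, g i)), a • m = θ a • m := fun _ _ _ => rfl
  refine CechLinear.of_surjective (DerActs.cechLinear (K := K) (x := MvPolynomial.X)
    (η := fun i b => MvPolynomial.pderiv i b) fun S => ⟨fun c m => ?_, fun i m => ?_,
    fun i m m' => ?_, fun i b => ?_⟩) θ.toRingHom weyl_mkAlgHom_surjective hs
  · rw [hs, AlgHom.commutes, weyl_algebraMap_smul]
  · exact (hnat S).1 i m
  · exact (hnat S).wD_smul_mul i m m'
  · exact (hnat S).wD_smul_algebraMap i b

lemma IsCechDiff.apply_eq_cechD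
    {ψ : ∀ S T : Finset (Fin r), S ⊆ T →
      (Localization.Away (∏ i ∈ S, g i) →ₐ[MvPolynomial (Fin n) K]
        Localization.Away (∏ i ∈ T, g i))}
    {d : ∀ k : ℕ, Cochain K n r g k →ₗ[Weyl K n] Cochain K n r g (k + 1)}
    (hd : IsCechDiff K n r g ψ d) (k : ℕ)
    (c : ∀ S : Finset (Fin r), Localization.Away (∏ i ∈ S, g i))
    (T : {S : Finset (Fin r) // S.card = k + 1}) :
    d k (fun S => c S.1) T = cechD g (fun S => Localization.Away (∏ i ∈ S, g i)) c T.1 := by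
  rw [hd, cechD_apply, ← Finset.sum_attach T.1]
  refine Finset.sum_congr rfl fun i _ => ?_
  rw [cechRes_unique g (fun S => Localization.Away (∏ i ∈ S, g i))
    (ψ (T.1.erase i.1) T.1 (Finset.erase_subset _ _)) 
    (cechRes g (fun S => Localization.Away (∏ i ∈ S, g i)) (T.1.erase_subset i.1))]
  congr!

lemma nonempty_cechCohomology
    {ψ : ∀ S T : Finset (Fin r), S ⊆ T →
      (Localization.Away (∏ i ∈ S, g i) →ₐ[MvPolynomial (Fin n) K]
        Localization.Away (∏ i ∈ T, g i))}
    {d : ∀ k : ℕ, Cochain K n r g k →ₗ[Weyl K n] Cochain K n r g (k + 1)}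
    (hd : IsCechDiff K n r g ψ d) {k : ℕ} {H : Type} [AddCommGroup H] [Module (Weyl K n) H]
    {π : LinearMap.ker (d k) →ₗ[Weyl K n] H} (hπ : IsCechCoh K n r g d k H π)
    (hlin : CechLinear (Weyl K n) g fun S => Localization.Away (∏ i ∈ S, g i)) :
    Nonempty (CechCohomology (Weyl K n) g (fun S => Localization.Away (∏ i ∈ S, g i))
      hlin k H) := by
  have hext : ∀ (k : ℕ) (m : Cochain K n r g k), ∃ c : ∀ S : Finset (Fin r),
      Localization.Away (∏ i ∈ S, g i),
      (fun S => c S.1 : Cochain K n r g k) = m := by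
    intro k m
    obtain ⟨c, hc⟩ := exists_extend_of_injective
      (e := fun S : {S : Finset (Fin r) // S.card = k} => S.1) Subtype.val_injective
      (L := fun S => Localization.Away (∏ i ∈ S, g i)) m
    exact ⟨c, funext hc⟩
  have hker : ∀ c : ∀ S : Finset (Fin r), Localization.Away (∏ i ∈ S, g i),
      CechCocycle g (fun S => Localization.Away (∏ i ∈ S, g i)) Finset.univ k c ↔
        d k (fun S => c S.1) = 0 := fun c => by
    refine ⟨fun h => funext fun T => ?_, fun h T _ hT => ?_⟩
    · rw [hd.apply_eq_cechD, h _ (Finset.subset_univ _) T.2]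
      rfl
    · exact (hd.apply_eq_cechD k c ⟨T, hT⟩).symm.trans (congrFun h ⟨T, hT⟩)
  let ρ : (∀ S : Finset (Fin r), Localization.Away (∏ i ∈ S, g i)) →ₗ[Weyl K n]
      Cochain K n r g k :=
    { toFun := fun c S => c S.1
      map_add' := fun _ _ => rfl
      map_smul' := fun _ _ => rfl }
  refine ⟨⟨π.comp ((ρ.domRestrict (hlin.cocycles k)).codRestrict (LinearMap.ker (d k))
    fun c => (hker c.1).1 c.2), fun x => ?_, fun c => ?_⟩⟩
  · obtain ⟨⟨m, hm⟩, rfl⟩ := hπ.1 x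
    obtain ⟨c, rfl⟩ := hext k m
    exact ⟨⟨c, (hker c).2 hm⟩, rfl⟩
  · rw [LinearMap.comp_apply, ← LinearMap.mem_ker, hπ.2, Submodule.mem_comap]
    change (fun S => c.1 S.1 : Cochain K n r g k) ∈ imPrev K n r g d k ↔ _
    cases k with
    | zero =>
      rw [imPrev, Submodule.mem_bot]
      refine ⟨fun h => ⟨0, fun S hS => ?_⟩, fun ⟨b, hb⟩ => funext fun S => ?_⟩
      · rw [map_zero]
        exact congrFun h ⟨S, hS⟩
      · exact (hb _ S.2).trans (cechD_of_card_eq_zero g _ b S.2)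
    | succ k =>
      rw [imPrev, LinearMap.mem_range]
      constructor
      · rintro ⟨m, hm⟩
        obtain ⟨b, rfl⟩ := hext k m
        refine ⟨b, fun S hS => ?_⟩
        rw [← congrFun hm ⟨S, hS⟩]
        exact hd.apply_eq_cechD k b ⟨S, hS⟩
      · rintro ⟨b, hb⟩
        refine ⟨fun S => b S.1, funext fun S => ?_⟩
        rw [hd.apply_eq_cechD, hb _ S.2]

end WeylRealization

section Kashiwara

variable {K A : Type*} [Field K] [CharZero K] [Ring A] [Algebra K A] {T P : A}

omit [CharZero K] [Algebra K A] in
lemma pow_mul_mul_add_nsmul (hTP : P * T = T * P + 1) (k : ℕ) :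
    T ^ k * (P * T) + k • T ^ k = P * T ^ (k + 1) := by
  induction k with
  | zero => simp
  | succ k ih =>
    calc T ^ (k + 1) * (P * T) + (k + 1) • T ^ (k + 1)
        = T * (T ^ k * (P * T) + k • T ^ k) + T ^ (k + 1) := by
          rw [pow_succ', succ_nsmul, mul_add, mul_smul_comm, mul_assoc, add_assoc]
      _ = (T * P + 1) * T ^ (k + 1) := by rw [ih, add_mul, one_mul, mul_assoc]
      _ = P * T ^ (k + 1 + 1) := by rw [← hTP, mul_assoc, ← pow_succ']

variable {M : Type*} [AddCommGroup M] [Module A M]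

omit [CharZero K] [Algebra K A] in
lemma pow_smul_nsmul_add (hTP : P * T = T * P + 1) {k : ℕ} {m : M} (hm : T ^ (k + 1) • m = 0) :
    T ^ k • (k • m + P • T • m) = 0 := by
  have := congrArg (· • m) (pow_mul_mul_add_nsmul hTP k)
  simp only [add_smul, mul_smul, hm, smul_zero, smul_assoc] at this
  rw [smul_add, smul_comm, add_comm]
  exact this

variable (K) in
include K in
lemma mem_of_nsmul_succ_mem (N : Submodule A M) {k : ℕ} {m : M} (h : (k + 1) • m ∈ N) : m ∈ N := by
  have h' := N.smul_mem (algebraMap K A ((k + 1 : ℕ) : K)⁻¹) h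
  rwa [← Nat.cast_smul_eq_nsmul A, smul_smul, ← map_natCast (algebraMap K A), ← map_mul,
    inv_mul_cancel₀ (Nat.cast_ne_zero.2 k.succ_ne_zero), map_one, one_smul] at h'

variable (K A) in
include K A in
lemma eq_zero_of_nsmul_succ_eq_zero {k : ℕ} {m : M} (h : (k + 1) • m = 0) : m = 0 :=
  (Submodule.mem_bot A).1 (mem_of_nsmul_succ_mem K ⊥ ((Submodule.mem_bot A).2 h))

variable (K) in
include K in
lemma exists_smul_eq_of_torsion (hTP : P * T = T * P + 1)
    (htor : ∀ m : M, ∃ k : ℕ, T ^ k • m = 0) (m : M) : ∃ x : M, T • x = m := by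
  obtain ⟨k, hk⟩ := htor m
  induction k generalizing m with
  | zero => exact ⟨0, by rw [smul_zero, ← hk, pow_zero, one_smul]⟩
  | succ k ih =>
    obtain ⟨x, hx⟩ := ih _ (pow_smul_nsmul_add hTP hk)
    refine ⟨algebraMap K A ((k + 1 : ℕ) : K)⁻¹ • (x - P • m), ?_⟩
    have e : T • (x - P • m) = (k + 1) • m := by
      rw [smul_sub, hx, smul_smul, smul_smul, hTP, add_smul, one_smul, succ_nsmul]
      abel
    rw [smul_smul, ← Algebra.commutes, ← smul_smul, e, ← Nat.cast_smul_eq_nsmul A, smul_smul,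
      ← map_natCast (algebraMap K A), ← map_mul,
      inv_mul_cancel₀ (Nat.cast_ne_zero.2 k.succ_ne_zero), map_one, one_smul]

variable (K) in
include K in
lemma eq_zero_of_mul_smul_eq_zero (hTP : P * T = T * P + 1) {m : M} {k : ℕ}
    (hk : T ^ k • m = 0) (hm : T • P • m = 0) : m = 0 := by
  induction k with
  | zero => rwa [pow_zero, one_smul] at hk
  | succ k ih =>
    have h := pow_smul_nsmul_add hTP hk
    have e : P • T • m = m := by
      rw [smul_smul, hTP, add_smul, mul_smul, hm, zero_add, one_smul]
    rw [e, ← succ_nsmul, smul_comm] at h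
    exact ih (eq_zero_of_nsmul_succ_eq_zero K A h)

variable (K) in
include K in
lemma le_span_inter_ker (hTP : P * T = T * P + 1)
    (htor : ∀ m : M, ∃ k : ℕ, T ^ k • m = 0) (N : Submodule A M) :
    N ≤ Submodule.span A {m | m ∈ N ∧ T • m = 0} := by
  intro m hm
  obtain ⟨k, hk⟩ := htor m
  induction k generalizing m with
  | zero =>
    rw [pow_zero, one_smul] at hk
    rw [hk]
    exact zero_mem _
  | succ k ih =>
    have hTm := N.smul_mem T hm
    have h1 := ih hTm (by rw [smul_smul, ← pow_succ, hk])
    have h2 := ih (N.add_mem (N.smul_of_tower_mem k hm) (N.smul_mem P hTm))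
      (pow_smul_nsmul_add hTP hk)
    rw [Submodule.add_mem_iff_left _ (Submodule.smul_mem _ P h1)] at h2
    cases k with
    | zero => exact Submodule.subset_span ⟨hm, by simpa using hk⟩
    | succ k => exact mem_of_nsmul_succ_mem K _ h2

variable {D : Type*} [Ring D] [Algebra K D] [Module D M] (θ : D →ₐ[K] A)

variable (T) in
/-- The kernel of `T`, as a module over a ring of operators commuting with `T`. -/
def kerSMul (hθ : ∀ a (m : M), a • m = θ a • m) (hT : ∀ a, Commute (θ a) T) : Submodule D M where
  carrier := {m | T • m = 0}
  zero_mem' := smul_zero T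
  add_mem' := fun {a b} ha hb => by
    change T • (a + b) = 0
    rw [smul_add, show T • a = 0 from ha, show T • b = 0 from hb, add_zero]
  smul_mem' := fun a m hm => by
    change T • a • m = 0
    rw [hθ, smul_smul, ← (hT a).eq, mul_smul, show T • m = 0 from hm, smul_zero]

variable (hθ : ∀ a (m : M), a • m = θ a • m) (hT : ∀ a, Commute (θ a) T)

omit [CharZero K] in
lemma exists_eq_add_of_mem_span (hTP : P * T = T * P + 1) (hP : ∀ a, Commute (θ a) P)
    (hgen : Algebra.adjoin K (Set.range θ ∪ {T, P}) = ⊤)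
    (N : Submodule D (kerSMul T θ hθ hT)) {m : M}
    (hm : m ∈ Submodule.span A (Subtype.val '' (N : Set (kerSMul T θ hθ hT)))) :
    ∃ v ∈ N, ∃ w : M, m = v + P • w := by
  let W : AddSubgroup M := AddSubgroup.closure {x | ∃ (j : ℕ) (v : _), v ∈ N ∧ x = P ^ j • v.1}
  have hW : ∀ j : ℕ, ∀ v ∈ N, P ^ j • (v : M) ∈ W := fun j v hv =>
    AddSubgroup.subset_closure ⟨j, v, hv, rfl⟩
  have hstab : ∀ a : A, (∀ j : ℕ, ∀ v ∈ N, a • P ^ j • (v : M) ∈ W) → ∀ w ∈ W, a • w ∈ W := by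
    intro a ha w hw
    induction hw using AddSubgroup.closure_induction with
    | mem x hx =>
      obtain ⟨j, v, hv, rfl⟩ := hx
      exact ha j v hv
    | zero => rw [smul_zero]; exact zero_mem _
    | add x y _ _ hx hy => rw [smul_add]; exact add_mem hx hy
    | neg x _ hx => rw [smul_neg]; exact neg_mem hx
  have hPW : ∀ w ∈ W, P • w ∈ W := hstab P fun j v hv => by
    rw [smul_smul, ← pow_succ']
    exact hW _ v hv
  have hTW : ∀ w ∈ W, T • w ∈ W := hstab T fun j v hv => by
    induction j with
    | zero =>
      rw [pow_zero, one_smul, show T • (v : M) = 0 from v.2]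
      exact zero_mem _
    | succ j ih =>
      rw [smul_smul, pow_succ', ← mul_assoc, ← sub_eq_iff_eq_add.2 hTP, sub_mul, one_mul,
        sub_smul, mul_assoc, mul_smul, mul_smul]
      exact sub_mem (hPW _ ih) (hW _ v hv)
  have hDW : ∀ a : D, ∀ w ∈ W, θ a • w ∈ W := fun a => hstab _ fun j v hv => by
    rw [smul_smul, ((hP a).pow_right j).eq, mul_smul, ← hθ]
    exact hW j _ (N.smul_mem a hv)
  have hAW : ∀ a : A, ∀ w ∈ W, a • w ∈ W := fun a => by
    have ha : a ∈ Algebra.adjoin K (Set.range θ ∪ {T, P}) := hgen ▸ Algebra.mem_top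
    induction ha using Algebra.adjoin_induction with
    | mem x hx =>
      rcases hx with ⟨a, rfl⟩ | rfl | rfl
      · exact hDW a
      · exact hTW
      · exact hPW
    | algebraMap c =>
      rw [← AlgHom.commutes θ]
      exact hDW _
    | add x y _ _ hx hy =>
      intro w hw
      rw [add_smul]
      exact add_mem (hx w hw) (hy w hw)
    | mul x y _ _ hx hy =>
      intro w hw
      rw [mul_smul]
      exact hx _ (hy w hw)
  have hmW : m ∈ W := by
    induction hm using Submodule.span_induction with
    | mem x hx =>
      obtain ⟨v, hv, rfl⟩ := hx
      simpa using hW 0 v hv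
    | zero => exact zero_mem _
    | add x y _ _ hx hy => exact add_mem hx hy
    | smul a x _ hx => exact hAW a x hx
  clear hm
  induction hmW using AddSubgroup.closure_induction with
  | mem x hx =>
    obtain ⟨j, v, hv, rfl⟩ := hx
    cases j with
    | zero => exact ⟨v, hv, 0, by simp⟩
    | succ j => exact ⟨0, zero_mem _, P ^ j • v.1, by rw [smul_smul, ← pow_succ']; simp⟩
  | zero => exact ⟨0, zero_mem _, 0, by simp⟩
  | add x y _ _ hx hy =>
    obtain ⟨v, hv, w, rfl⟩ := hx
    obtain ⟨v', hv', w', rfl⟩ := hy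
    exact ⟨v + v', add_mem hv hv', w + w', by rw [smul_add, Submodule.coe_add]; abel⟩
  | neg x _ hx =>
    obtain ⟨v, hv, w, rfl⟩ := hx
    exact ⟨-v, neg_mem hv, -w, by rw [smul_neg, Submodule.coe_neg]; abel⟩

/-- The lattice-theoretic form of Kashiwara's equivalence: if `P` and `T` satisfy the Heisenberg
relation and `M` is `T`-torsion, submodules of `M` correspond to submodules of the kernel
of `T`. -/
noncomputable def submoduleOrderIsoKerSMul (hTP : P * T = T * P + 1) (hP : ∀ a, Commute (θ a) P)
    (hgen : Algebra.adjoin K (Set.range θ ∪ {T, P}) = ⊤)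
    (htor : ∀ m : M, ∃ k : ℕ, T ^ k • m = 0) :
    Submodule A M ≃o Submodule D (kerSMul T θ hθ hT) :=
  Equiv.toOrderIso
    { toFun := fun N =>
        { carrier := {x | x.1 ∈ N}
          zero_mem' := N.zero_mem
          add_mem' := fun ha hb => N.add_mem ha hb
          smul_mem' := fun a x hx => by
            change a • x.1 ∈ N
            rw [hθ]
            exact N.smul_mem _ hx }
      invFun := fun N => Submodule.span A (Subtype.val '' (N : Set (kerSMul T θ hθ hT)))
      left_inv := fun N => by
        refine le_antisymm (Submodule.span_le.2 ?_) ((le_span_inter_ker K hTP htor N).trans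
          (Submodule.span_mono ?_))
        · rintro _ ⟨x, hx, rfl⟩
          exact hx
        · rintro m ⟨hm, hm0⟩
          exact ⟨⟨m, hm0⟩, hm, rfl⟩
      right_inv := fun N => by
        ext x
        refine ⟨fun hx => ?_, fun hx => Submodule.subset_span ⟨x, hx, rfl⟩⟩
        obtain ⟨v, hv, w, e⟩ := exists_eq_add_of_mem_span θ hθ hT hTP hP hgen N hx
        obtain ⟨k, hk⟩ := htor w
        have hw : w = 0 := eq_zero_of_mul_smul_eq_zero K hTP hk (by
          have h := congrArg (T • ·) e
          simpa [smul_add, show T • x.1 = 0 from x.2, show T • v.1 = 0 from v.2] using h.symm)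
        have : x = v := Subtype.ext (by rw [e, hw, smul_zero, add_zero])
        rwa [this] }
    (fun N N' h x hx => h hx)
    (fun N N' h => Submodule.span_mono (Set.image_mono h))

end Kashiwara

section QuotientLocalization

variable {B B' : Type*} [CommRing B] [CommRing B'] {L L' : Type*} [CommRing L] [CommRing L']
  [Algebra B L] [Algebra B' L'] (φ : B →+* B') (f : B) (f' : B') [IsLocalization.Away f L]
  [IsLocalization.Away f' L']

lemma exists_awayMap_of_surjective (hf : f' = φ f) (hφ : Function.Surjective φ) {t : B}
    (ht : RingHom.ker φ = Ideal.span {t}) :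
    ∃ p : L →+* L', (∀ b, p (algebraMap B L b) = algebraMap B' L' (φ b)) ∧
      Function.Surjective p ∧ ∀ x, p x = 0 ↔ ∃ y, t • y = x := by
  have hu : IsUnit (((algebraMap B' L').comp φ) f) := by
    rw [RingHom.comp_apply, ← hf]
    exact IsLocalization.Away.algebraMap_isUnit f'
  obtain ⟨p, hp⟩ : ∃ p : L →+* L', ∀ b, p (algebraMap B L b) = algebraMap B' L' (φ b) :=
    ⟨IsLocalization.Away.lift f hu, fun b => IsLocalization.Away.lift_eq f hu b⟩
  have hfu : IsUnit (algebraMap B L f) := IsLocalization.Away.algebraMap_isUnit f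
  have hfu' : IsUnit (algebraMap B' L' f') := IsLocalization.Away.algebraMap_isUnit f'
  refine ⟨p, hp, fun y => ?_, fun x => ⟨fun hx => ?_, ?_⟩⟩
  · obtain ⟨n, r, hr⟩ := IsLocalization.Away.surj f' y
    obtain ⟨r, rfl⟩ := hφ r
    obtain ⟨u, hu⟩ := hfu.pow n
    refine ⟨algebraMap B L r * ↑u⁻¹, (hfu'.pow n).mul_right_cancel ?_⟩
    rw [hr, ← hp r, hf, ← hp, ← map_pow, ← map_mul, ← hu, mul_assoc, Units.inv_mul, mul_one]
  · obtain ⟨n, r, hr⟩ := IsLocalization.Away.surj f x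
    have h0 : algebraMap B' L' (φ r) = algebraMap B' L' 0 := by
      rw [← hp, ← hr, map_mul, hx, zero_mul, map_zero]
    obtain ⟨⟨_, m, rfl⟩, hm⟩ := (IsLocalization.eq_iff_exists (Submonoid.powers f') L').1 h0
    have hk : f ^ m * r ∈ Ideal.span {t} := by
      rw [← ht, RingHom.mem_ker, map_mul, map_pow, ← hf]
      simpa using hm
    obtain ⟨q, hq⟩ := Ideal.mem_span_singleton'.1 hk
    obtain ⟨u, hu⟩ := hfu.pow (n + m)
    refine ⟨algebraMap B L q * ↑u⁻¹, (hfu.pow (n + m)).mul_right_cancel ?_⟩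
    have h1 : x * algebraMap B L f ^ (n + m) = algebraMap B L (f ^ m * r) := by
      rw [pow_add, ← mul_assoc, hr, map_mul, map_pow, mul_comm]
    rw [h1, ← hq, ← hu, Algebra.smul_def, mul_assoc, mul_assoc, Units.inv_mul, mul_one, map_mul,
      mul_comm]
  · rintro ⟨y, rfl⟩
    have h0 : φ t = 0 := by
      rw [← RingHom.mem_ker, ht]
      exact Ideal.mem_span_singleton_self t
    rw [Algebra.smul_def, map_mul, hp, h0, map_zero, zero_mul]

lemma eq_zero_of_smul_eq_zero_of_isLocalization [IsDomain B] (M : Submonoid B) [IsLocalization M L]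
    {t : B} (ht : t ≠ 0) {x : L} (hx : t • x = 0) : x = 0 := by
  obtain ⟨⟨r, s⟩, hr⟩ := IsLocalization.surj M x
  have h0 : algebraMap B L (t * r) = algebraMap B L 0 := by
    rw [map_mul, ← hr, ← mul_assoc, ← Algebra.smul_def, hx, zero_mul, map_zero]
  obtain ⟨c, hc⟩ := (IsLocalization.eq_iff_exists M L).1 h0
  have h1 : (c : B) * r = 0 := by
    refine (mul_eq_zero.1 (?_ : t * (c * r) = 0)).resolve_left ht
    rw [mul_left_comm, hc, mul_zero]
  have h2 : algebraMap B L r = 0 :=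
    (IsLocalization.map_units L c).mul_left_cancel (by rw [← map_mul, h1, map_zero, mul_zero])
  exact (IsLocalization.map_units L s).mul_right_cancel (by rw [hr, h2, zero_mul])

end QuotientLocalization

section KernelOnCohomology

variable {ι : Type*} [LinearOrder ι] [Fintype ι] {B B' : Type*} [CommRing B] [CommRing B']
  {D : Type*} [Ring D] {φ : B →+* B'} {g : ι → B} {g' : ι → B'}
  {L L' : Finset ι → Type*} [∀ S, CommRing (L S)] [∀ S, Algebra B (L S)]
  [∀ S, IsLocalization.Away (∏ i ∈ S, g i) (L S)] [∀ S, Module D (L S)]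
  [∀ S, CommRing (L' S)] [∀ S, Algebra B' (L' S)]
  [∀ S, IsLocalization.Away (∏ i ∈ S, g' i) (L' S)] [∀ S, Module D (L' S)]

omit [Fintype ι] [∀ S, Module D (L S)] [∀ S, Module D (L' S)] in
lemma cechD_map (p : ∀ S, L S →+* L' S)
    (hp : ∀ S b, p S (algebraMap B (L S) b) = algebraMap B' (L' S) (φ b)) (c : ∀ S, L S)
    (T : Finset ι) : cechD g' L' (fun S => p S (c S)) T = p T (cechD g L c T) := by
  rw [cechD_apply, cechD_apply, map_sum]
  refine Finset.sum_congr rfl fun i _ => ?_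
  rw [map_zsmul]
  congr 1
  have h : ((cechRes g' L' (T.erase_subset i) : _ →+* _).comp (p (T.erase i))) =
      (p T).comp (cechRes g L (T.erase_subset i) : _ →+* _) := by
    refine IsLocalization.ringHom_ext (Submonoid.powers (∏ i ∈ T.erase i, g i)) ?_
    ext b
    simp [hp]
  exact DFunLike.congr_fun h _

/-- The kernel of multiplication by `t` on Čech cohomology in degree `k + 1` is the Čech
cohomology of the reduction modulo `t` in degree `k`, provided that multiplication by `t` is
surjective on cohomology in degree `k`. -/
lemma CechCohomology.nonempty_ker_linearEquiv {hL : CechLinear D g L} {hL' : CechLinear D g' L'}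
    {t : B} (p : ∀ S, L S →+* L' S)
    (hp : ∀ S b, p S (algebraMap B (L S) b) = algebraMap B' (L' S) (φ b))
    (hps : ∀ S, Function.Surjective (p S)) (hpk : ∀ S x, p S x = 0 ↔ ∃ y, t • y = x)
    (hpD : ∀ S (a : D) x, p S (a • x) = a • p S x)
    (htD : ∀ S (a : D) (x : L S), a • t • x = t • a • x)
    (ht : ∀ S (x : L S), t • x = 0 → x = 0) {k : ℕ}
    (hdiv : ∀ c ∈ hL.cocycles k, ∃ w b : ∀ S, L S,
      ∀ S : Finset ι, S.card = k → c S = t • w S + cechD g L b S)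
    {H H' : Type*} [AddCommGroup H] [Module D H] [AddCommGroup H'] [Module D H']
    (hH : CechCohomology D g L hL (k + 1) H) (hH' : CechCohomology D g' L' hL' k H')
    (N : Submodule D H) (hN : ∀ c, hH.proj c ∈ N ↔
      ∃ b : ∀ S, L S, ∀ S : Finset ι, S.card = k + 1 → cechD g L b S = t • c.1 S) :
    Nonempty (N ≃ₗ[D] H') := by
  let q : (∀ S, L S) →ₗ[D] (∀ S, L' S) :=
    { toFun := fun c S => p S (c S)
      map_add' := fun c c' => by ext S; simp
      map_smul' := fun a c => by ext S; simp [hpD] }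
  have hqd : ∀ c T, cechD g' L' (q c) T = p T (cechD g L c T) := cechD_map p hp
  have hq : Function.Surjective q := fun c' => by
    choose c hc using fun S => hps S (c' S)
    exact ⟨c, funext hc⟩
  have hpt : ∀ S (x : L S), p S (t • x) = 0 := fun S x => (hpk S _).2 ⟨x, rfl⟩
  let E : Submodule D ((∀ S, L S) × hL.cocycles (k + 1)) :=
    { carrier := {x | ∀ S : Finset ι, S.card = k + 1 → cechD g L x.1 S = t • x.2.1 S}
      zero_mem' := fun S _ => by simp
      add_mem' := fun {x y} hx hy S hS => by
        simp only [Prod.fst_add, map_add, Pi.add_apply, hx S hS, hy S hS, Prod.snd_add,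
          Submodule.coe_add, smul_add]
      smul_mem' := fun a x hx S hS => by
        simp only [Prod.smul_fst, hL.cechD_smul, Pi.smul_apply, hx S hS, Prod.smul_snd,
          Submodule.coe_smul, htD] }
  have hcoc : ∀ x : E, q x.1.1 ∈ hL'.cocycles k := fun x T _ hT => by
    rw [hqd, x.2 T hT, hpt]
  let F' : E →ₗ[D] hL'.cocycles k :=
    ((q.comp (LinearMap.fst D _ _)).comp E.subtype).codRestrict (hL'.cocycles k) hcoc
  let F : E →ₗ[D] N := ((hH.proj.comp (LinearMap.snd D _ _)).comp E.subtype).codRestrict N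
    fun x => (hN _).2 ⟨x.1.1, x.2⟩
  let G : E →ₗ[D] H' := hH'.proj.comp F'
  refine nonempty_linearEquiv_of_ker_eq D (M := E) F G ?_ ?_ ?_
  · rintro ⟨x, hx⟩
    obtain ⟨z, rfl⟩ := hH.surjective x
    obtain ⟨b, hb⟩ := (hN z).1 hx
    exact ⟨⟨(b, z), hb⟩, rfl⟩
  · intro x
    obtain ⟨⟨c', hc'⟩, rfl⟩ := hH'.surjective x
    obtain ⟨b, rfl⟩ := hq c'
    have hz : ∀ S : Finset ι, ∃ z : L S, S.card = k + 1 → t • z = cechD g L b S := fun S => by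
      by_cases hS : S.card = k + 1
      · have h := hc' S (Finset.subset_univ S) hS
        rw [hqd] at h
        obtain ⟨z, hz⟩ := (hpk S _).1 h
        exact ⟨z, fun _ => hz⟩
      · exact ⟨0, fun h => absurd h hS⟩
    choose z hz using hz
    have hzc : z ∈ hL.cocycles (k + 1) := fun T _ hT => ht T _ <| by
      have h : cechD g L (t • z) T = cechD g L (cechD g L b) T := cechD_congr g L fun i hi => by
        rw [Pi.smul_apply, hz _ (by rw [Finset.card_erase_of_mem hi, hT]; rfl)]
      rw [map_smul, cechD_cechD] at h
      exact h
    exact ⟨⟨(b, ⟨z, hzc⟩), fun S hS => (hz S hS).symm⟩, rfl⟩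
  · rintro ⟨⟨b, z⟩, hbz⟩
    have hbz : ∀ S : Finset ι, S.card = k + 1 → cechD g L b S = t • z.1 S := hbz
    have e1 : F ⟨(b, z), hbz⟩ = 0 ↔ hH.proj z = 0 := by
      rw [← Submodule.coe_eq_zero]
      rfl
    rw [e1, hH.proj_eq_zero_iff, show G ⟨(b, z), hbz⟩ = hH'.proj (F' ⟨(b, z), hbz⟩) from rfl,
      hH'.proj_eq_zero_iff]
    change _ ↔ ∃ b' : ∀ S, L' S, ∀ S : Finset ι, S.card = k → p S (b S) = cechD g' L' b' S
    constructor
    · rintro ⟨y, hy⟩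
      obtain ⟨w, u, hwu⟩ := hdiv (b - t • y) fun T _ hT => by
        rw [map_sub, map_smul, Pi.sub_apply, Pi.smul_apply, hbz T hT, hy T hT, sub_self]
      refine ⟨q u, fun S hS => ?_⟩
      have h := congrArg (p S) (hwu S hS)
      rw [Pi.sub_apply, Pi.smul_apply, map_sub, map_add, hpt, hpt, zero_add, sub_zero] at h
      rw [h, hqd]
    · rintro ⟨u', hu'⟩
      obtain ⟨u, rfl⟩ := hq u'
      have hy : ∀ S : Finset ι, ∃ y : L S, S.card = k → t • y = b S - cechD g L u S := fun S => by
        by_cases hS : S.card = k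
        · have h := hu' S hS
          rw [hqd, ← sub_eq_zero, ← map_sub] at h
          obtain ⟨y, hy⟩ := (hpk S _).1 h
          exact ⟨y, fun _ => hy⟩
        · exact ⟨0, fun h => absurd h hS⟩
      choose y hy using hy
      refine ⟨y, fun S hS => ?_⟩
      rw [← sub_eq_zero]
      refine ht S _ ?_
      have h : cechD g L (t • y) S = cechD g L (b - cechD g L u) S :=
        cechD_congr g L fun i hi => by
          rw [Pi.smul_apply, hy _ (by rw [Finset.card_erase_of_mem hi, hS]; rfl), Pi.sub_apply]
      rw [map_sub, cechD_cechD, sub_zero, map_smul, Pi.smul_apply, hbz S hS] at h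
      rw [smul_sub, h, sub_self]

end KernelOnCohomology

section WeylPolynomials

variable (K : Type) [Field K] (n : ℕ)

open scoped IsMulCommutative in
/-- The inclusion of the polynomial ring into the Weyl algebra. -/
noncomputable def weylPoly : MvPolynomial (Fin n) K →ₐ[K] Weyl K n :=
  have : IsMulCommutative (Algebra.adjoin K (Set.range (wX K n))) :=
    Algebra.isMulCommutative_adjoin K (by
      rintro _ ⟨i, rfl⟩ _ ⟨j, rfl⟩
      exact wX_mul_wX i j)
  (Algebra.adjoin K (Set.range (wX K n))).val.comp
    (MvPolynomial.aeval fun i =>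
      (⟨wX K n i, Algebra.subset_adjoin ⟨i, rfl⟩⟩ : Algebra.adjoin K (Set.range (wX K n))))

variable {K n}

lemma weylPoly_X (i : Fin n) : weylPoly K n (MvPolynomial.X i) = wX K n i := by
  simp [weylPoly]

lemma weylPoly_C (c : K) : weylPoly K n (MvPolynomial.C c) = algebraMap K (Weyl K n) c :=
  (weylPoly K n).commutes c

lemma wD_mul_weylPoly (i : Fin n) (f : MvPolynomial (Fin n) K) :
    wD K n i * weylPoly K n f =
      weylPoly K n f * wD K n i + weylPoly K n (MvPolynomial.pderiv i f) := by
  induction f using MvPolynomial.induction_on with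
  | C c => rw [weylPoly_C, MvPolynomial.pderiv_C, map_zero, add_zero, Algebra.commutes]
  | add p q hp hq =>
    rw [map_add, mul_add, hp, hq, map_add, map_add, add_mul]
    abel
  | mul_X p j hp =>
    rw [map_mul, ← mul_assoc, hp, weylPoly_X, add_mul, mul_assoc, wD_mul_wX,
      Derivation.leibniz, MvPolynomial.pderiv_X, mul_add, ← mul_assoc, map_add, smul_eq_mul,
      smul_eq_mul, mul_comm (MvPolynomial.X j), map_mul, map_mul, weylPoly_X, add_assoc]
    congr 2
    by_cases h : i = j
    · subst h
      simp
    · simp [h]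

variable {f : MvPolynomial (Fin n) K}
  [Module (Weyl K n) (Localization.Away f)] [IsScalarTower K (Weyl K n) (Localization.Away f)]

lemma NatActs.weylPoly_smul (h : NatActs K n f) (b : MvPolynomial (Fin n) K)
    (m : Localization.Away f) : weylPoly K n b • m = b • m := by
  rw [Algebra.smul_def]
  induction b using MvPolynomial.induction_on generalizing m with
  | C c =>
    rw [weylPoly_C, weyl_algebraMap_smul]
    rfl
  | add p q hp hq => rw [map_add, add_smul, hp, hq, map_add, add_mul]
  | mul_X p j hp => rw [map_mul, mul_smul, weylPoly_X, h.1, hp, map_mul, mul_assoc]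

/-- The element of the Weyl algebra attached to a derivation of the polynomial ring. -/
noncomputable def weylDer (η : Derivation K (MvPolynomial (Fin n) K) (MvPolynomial (Fin n) K)) :
    Weyl K n :=
  ∑ j, weylPoly K n (η (MvPolynomial.X j)) * wD K n j

lemma weylDer_pderiv (i : Fin n) : weylDer (MvPolynomial.pderiv (R := K) i) = wD K n i := by
  rw [weylDer, Finset.sum_eq_single i]
  · simp
  · intro j _ hj
    simp [MvPolynomial.pderiv_X_of_ne hj]
  · simp

lemma derivation_sum_apply {A M ι : Type*} [CommSemiring A] [AddCommGroup M] [Algebra K A]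
    [Module A M] [Module K M] (s : Finset ι) (η : ι → Derivation K A M) (b : A) :
    (∑ i ∈ s, η i) b = ∑ i ∈ s, η i b := by
  classical
  induction s using Finset.induction_on with
  | empty => simp
  | insert i s hi ih => rw [Finset.sum_insert hi, Finset.sum_insert hi, Derivation.add_apply, ih]

lemma weylDer_sum {ι : Type*} (s : Finset ι) (c : ι → MvPolynomial (Fin n) K)
    (η : ι → Derivation K (MvPolynomial (Fin n) K) (MvPolynomial (Fin n) K)) :
    weylDer (∑ i ∈ s, c i • η i) = ∑ i ∈ s, weylPoly K n (c i) * weylDer (η i) := by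
  simp only [weylDer, Finset.mul_sum]
  rw [Finset.sum_comm]
  refine Finset.sum_congr rfl fun j _ => ?_
  rw [derivation_sum_apply, map_sum, Finset.sum_mul]
  refine Finset.sum_congr rfl fun i _ => ?_
  rw [Derivation.smul_apply, smul_eq_mul, map_mul, mul_assoc]

lemma derivation_eq_sum_pderiv
    (η : Derivation K (MvPolynomial (Fin n) K) (MvPolynomial (Fin n) K)) :
    η = ∑ j, η (MvPolynomial.X j) • MvPolynomial.pderiv j := by
  refine MvPolynomial.derivation_ext fun i => ?_
  rw [derivation_sum_apply, Finset.sum_eq_single i]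
  · simp
  · intro j _ hj
    simp [MvPolynomial.pderiv_X_of_ne hj.symm]
  · simp

lemma weylDer_mul_weylPoly
    (η : Derivation K (MvPolynomial (Fin n) K) (MvPolynomial (Fin n) K))
    (b : MvPolynomial (Fin n) K) :
    weylDer η * weylPoly K n b = weylPoly K n b * weylDer η + weylPoly K n (η b) := by
  have hb : η b = ∑ j, η (MvPolynomial.X j) * MvPolynomial.pderiv j b := by
    conv_lhs => rw [derivation_eq_sum_pderiv η, derivation_sum_apply]
    rfl
  rw [hb, map_sum, weylDer,
    Finset.sum_mul, Finset.mul_sum, ← Finset.sum_add_distrib]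
  refine Finset.sum_congr rfl fun j _ => ?_
  rw [mul_assoc, wD_mul_weylPoly, mul_add, ← mul_assoc, ← map_mul, mul_comm (η _) b, map_mul,
    mul_assoc, map_mul]

lemma NatActs.weylDer_smul_mul (h : NatActs K n f)
    (η : Derivation K (MvPolynomial (Fin n) K) (MvPolynomial (Fin n) K))
    (m m' : Localization.Away f) :
    weylDer η • (m * m') = m * weylDer η • m' + m' * weylDer η • m := by
  simp only [weylDer, Finset.sum_smul, mul_smul, h.weylPoly_smul, h.wD_smul_mul, smul_add,
    Finset.mul_sum, Finset.sum_add_distrib, mul_smul_comm]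

lemma NatActs.weylDer_smul_algebraMap (h : NatActs K n f)
    (η : Derivation K (MvPolynomial (Fin n) K) (MvPolynomial (Fin n) K))
    (b : MvPolynomial (Fin n) K) :
    weylDer η • algebraMap (MvPolynomial (Fin n) K) (Localization.Away f) b =
      algebraMap (MvPolynomial (Fin n) K) (Localization.Away f) (η b) := by
  conv_rhs => rw [derivation_eq_sum_pderiv η]
  rw [derivation_sum_apply, map_sum, weylDer, Finset.sum_smul]
  refine Finset.sum_congr rfl fun j _ => ?_
  rw [mul_smul, h.wD_smul_algebraMap, h.weylPoly_smul, Derivation.smul_apply, smul_eq_mul,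
    map_mul, Algebra.smul_def]

/-- A family of polynomials and derivations defines an algebra homomorphism from the free algebra
to the Weyl algebra. -/
noncomputable def weylLift {I J : Type*} (x : I → MvPolynomial (Fin n) K)
    (η : J → Derivation K (MvPolynomial (Fin n) K) (MvPolynomial (Fin n) K)) :
    FreeAlgebra K (I ⊕ J) →ₐ[K] Weyl K n :=
  FreeAlgebra.lift K (Sum.elim (fun i => weylPoly K n (x i)) fun j => weylDer (η j))

lemma NatActs.derActs (h : NatActs K n f) {I J : Type*} (x : I → MvPolynomial (Fin n) K)
    (η : J → Derivation K (MvPolynomial (Fin n) K) (MvPolynomial (Fin n) K))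
    [Module (FreeAlgebra K (I ⊕ J)) (Localization.Away f)]
    (hs : ∀ a (m : Localization.Away f), a • m = weylLift x η a • m) :
    DerActs K x (fun j => η j) (Localization.Away f) where
  algebraMap_smul c m := by rw [hs, AlgHom.commutes, weyl_algebraMap_smul]
  inl_smul i m := by
    rw [hs, weylLift, FreeAlgebra.lift_ι_apply, Sum.elim_inl, h.weylPoly_smul, Algebra.smul_def]
  inr_smul_mul j m m' := by
    simp only [hs, weylLift, FreeAlgebra.lift_ι_apply, Sum.elim_inr]
    exact h.weylDer_smul_mul (η j) m m'
  inr_smul_algebraMap j b := by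
    simp only [hs, weylLift, FreeAlgebra.lift_ι_apply, Sum.elim_inr]
    exact h.weylDer_smul_algebraMap (η j) b

/-- The homomorphism is surjective if the `x i` generate the polynomial ring and the derivations
satisfy `η i (x j) = δ_ij`. -/
lemma weylLift_surjective {I : Type*} [Fintype I] [DecidableEq I] (x : I → MvPolynomial (Fin n) K)
    (η : I → Derivation K (MvPolynomial (Fin n) K) (MvPolynomial (Fin n) K))
    (hx : Algebra.adjoin K (Set.range x) = ⊤) (hη : ∀ i j, η i (x j) = if i = j then 1 else 0) :
    Function.Surjective (weylLift x η) := by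
  have hP : ∀ b, weylPoly K n b ∈ (weylLift x η).range := by
    intro b
    have hb : b ∈ Algebra.adjoin K (Set.range x) := hx ▸ Algebra.mem_top
    have h := Subalgebra.mem_map.2 ⟨b, hb, (rfl : (weylPoly K n) b = weylPoly K n b)⟩
    rw [AlgHom.map_adjoin] at h
    refine Algebra.adjoin_le ?_ h
    rintro _ ⟨_, ⟨i, rfl⟩, rfl⟩
    exact ⟨FreeAlgebra.ι K (Sum.inl i), by simp [weylLift]⟩
  have hD : ∀ j, wD K n j ∈ (weylLift x η).range := by
    intro j
    have e : MvPolynomial.pderiv j = ∑ i, (MvPolynomial.pderiv j (x i)) • η i := by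
      refine Derivation.ext_of_adjoin_eq_top _ hx ?_
      rintro _ ⟨k, rfl⟩
      rw [derivation_sum_apply]
      simp [hη]
    rw [← weylDer_pderiv, e, weylDer_sum]
    exact sum_mem fun i _ => mul_mem (hP _) ⟨FreeAlgebra.ι K (Sum.inr i), by simp [weylLift]⟩
  rw [← AlgHom.range_eq_top, eq_top_iff, ← weyl_adjoin]
  refine Algebra.adjoin_le ?_
  rintro _ (⟨i, rfl⟩ | ⟨j, rfl⟩)
  · rw [← weylPoly_X]
    exact hP _
  · exact hD j

end WeylPolynomials

section AffineLinear

variable {K : Type*} [Field K] {n : ℕ}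

lemma eq_affine_of_totalDegree_le_one {σ : Type*} [Fintype σ] {h : MvPolynomial σ K}
    (hdeg : h.totalDegree ≤ 1) :
    ∃ (a : σ → K) (b : K), h = ∑ i, MvPolynomial.C (a i) * MvPolynomial.X i + MvPolynomial.C b := by
  classical
  refine ⟨fun i => h.coeff (Finsupp.single i 1), h.coeff 0, ?_⟩
  ext s
  simp only [MvPolynomial.coeff_add, MvPolynomial.coeff_sum, MvPolynomial.coeff_C_mul,
    MvPolynomial.coeff_X, MvPolynomial.coeff_C, mul_ite, mul_one, mul_zero]
  by_cases hs : ∃ i, Finsupp.single i 1 = s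
  · obtain ⟨i, rfl⟩ := hs
    rw [Finset.sum_eq_single i]
    · rw [if_pos rfl, if_neg (Finsupp.single_ne_zero.2 one_ne_zero).symm, add_zero]
    · intro j _ hj
      rw [if_neg]
      intro e
      exact hj (Finsupp.single_left_injective one_ne_zero e)
    · simp
  · rw [Finset.sum_eq_zero fun i _ => if_neg fun e => hs ⟨i, e⟩, zero_add]
    split_ifs with h0
    · rw [h0]
    · by_contra hne
      have h1 := MvPolynomial.le_totalDegree (MvPolynomial.mem_support_iff.2 hne)
      have h2 : s.degree = 1 := by
        refine le_antisymm (h1.trans hdeg) (Nat.one_le_iff_ne_zero.2 fun h => h0 ?_)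
        exact ((Finsupp.degree_eq_zero_iff s).1 h).symm
      obtain ⟨i, hi⟩ := Finsupp.ne_iff.1 (Ne.symm h0)
      have hle : Finsupp.single i 1 ≤ s := Finsupp.single_le_iff.2 (Nat.one_le_iff_ne_zero.2 hi)
      have h3 := congrArg Finsupp.degree (tsub_add_cancel_of_le hle)
      rw [map_add, Finsupp.degree_single, h2, Nat.add_eq_right, Finsupp.degree_eq_zero_iff] at h3
      exact hs ⟨i, le_antisymm hle (tsub_eq_zero_iff_le.1 h3)⟩

end AffineLinear

section HyperplaneCoordinates

lemma commute_weylLift {K : Type} [Field K] {n : ℕ} {I J : Type*}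
    {x : I → MvPolynomial (Fin n) K}
    {η : J → Derivation K (MvPolynomial (Fin n) K) (MvPolynomial (Fin n) K)} {T : Weyl K n}
    (hx : ∀ i, Commute (weylPoly K n (x i)) T) (hη : ∀ j, Commute (weylDer (η j)) T)
    (q : FreeAlgebra K (I ⊕ J)) : Commute (weylLift x η q) T := by
  induction q using FreeAlgebra.induction with
  | grade0 c =>
    rw [AlgHom.commutes]
    exact Algebra.commutes c T
  | grade1 s =>
    rw [weylLift, FreeAlgebra.lift_ι_apply]
    rcases s with i | j
    · exact hx i
    · exact hη j
  | mul p q hp hq =>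
    rw [map_mul]
    exact hp.mul_left hq
  | add p q hp hq =>
    rw [map_add]
    exact hp.add_left hq

variable {K : Type} [Field K] {n : ℕ} (a : Fin (n + 1) → K) (m : Fin (n + 1))

/-- The derivations of the polynomial ring along the hyperplane `∑ i, a i * X i + b = 0`. -/
noncomputable def planeDer (i : Fin n) :
    Derivation K (MvPolynomial (Fin (n + 1)) K) (MvPolynomial (Fin (n + 1)) K) :=
  MvPolynomial.pderiv (m.succAbove i) - (a (m.succAbove i) / a m) • MvPolynomial.pderiv m

lemma weylDer_planeDer (i : Fin n) : weylDer (planeDer a m i) =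
    wD K (n + 1) (m.succAbove i) -
      algebraMap K (Weyl K (n + 1)) (a (m.succAbove i) / a m) * wD K (n + 1) m := by
  rw [← weylDer_pderiv, ← weylDer_pderiv]
  simp only [weylDer, planeDer, Finset.mul_sum, ← Finset.sum_sub_distrib, Derivation.sub_apply,
    Derivation.smul_apply, map_sub, map_smul, sub_mul, smul_mul_assoc, ← Algebra.smul_def]

lemma planeDer_X (i j : Fin n) :
    planeDer a m i (MvPolynomial.X (m.succAbove j)) = if i = j then 1 else 0 := by
  classical
  simp [planeDer, MvPolynomial.pderiv_X, Pi.single_apply, eq_comm]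

variable {a m} {b : K} {h : MvPolynomial (Fin (n + 1)) K}
  (hh : h = ∑ i, MvPolynomial.C (a i) * MvPolynomial.X i + MvPolynomial.C b) (hm : a m ≠ 0)

include hh

lemma pderiv_of_eq_affine (i : Fin (n + 1)) : MvPolynomial.pderiv i h = MvPolynomial.C (a i) := by
  classical
  simp [hh, MvPolynomial.pderiv_X, Pi.single_apply]

lemma weylPoly_of_eq_affine : weylPoly K (n + 1) h =
    ∑ i, algebraMap K _ (a i) * wX K (n + 1) i + algebraMap K _ b := by
  simp only [hh, map_add, map_sum, map_mul, weylPoly_C, weylPoly_X]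

include hm

lemma planeDer_eq_zero (i : Fin n) : planeDer a m i h = 0 := by
  rw [planeDer, Derivation.sub_apply, Derivation.smul_apply, pderiv_of_eq_affine hh,
    pderiv_of_eq_affine hh, MvPolynomial.smul_eq_C_mul, ← map_mul, div_mul_cancel₀ _ hm, sub_self]

lemma inv_wD_mul_weylPoly :
    (algebraMap K (Weyl K (n + 1)) (a m)⁻¹ * wD K (n + 1) m) * weylPoly K (n + 1) h =
      weylPoly K (n + 1) h * (algebraMap K (Weyl K (n + 1)) (a m)⁻¹ * wD K (n + 1) m) + 1 := by
  rw [mul_assoc, wD_mul_weylPoly, pderiv_of_eq_affine hh, mul_add, weylPoly_C, ← map_mul,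
    inv_mul_cancel₀ hm, map_one, ← mul_assoc, Algebra.commutes, mul_assoc]

lemma commute_weylLift_planeDer_weylPoly (q : FreeAlgebra K (Fin n ⊕ Fin n)) :
    Commute (weylLift (fun i => MvPolynomial.X (m.succAbove i)) (planeDer a m) q)
      (weylPoly K (n + 1) h) := by
  refine commute_weylLift (fun i => ?_) (fun j => ?_) q
  · exact (Commute.all _ _).map (weylPoly K (n + 1))
  · rw [commute_iff_eq, weylDer_mul_weylPoly, planeDer_eq_zero hh hm, map_zero, add_zero]

omit hh hm in
lemma commute_weylLift_planeDer_wD (c : K) (q : FreeAlgebra K (Fin n ⊕ Fin n)) :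
    Commute (weylLift (fun i => MvPolynomial.X (m.succAbove i)) (planeDer a m) q)
      (algebraMap K (Weyl K (n + 1)) c * wD K (n + 1) m) := by
  have hc : ∀ (c : K) w, Commute (algebraMap K (Weyl K (n + 1)) c) w := Algebra.commutes
  refine commute_weylLift (fun i => ?_) (fun j => ?_) q
  · refine ((hc _ _).symm).mul_right (Commute.symm ?_)
    rw [commute_iff_eq, weylPoly_X, wD_mul_wX, if_neg (Fin.succAbove_ne m i).symm, add_zero]
  · have hD : ∀ i j, Commute (wD K (n + 1) i) (wD K (n + 1) j) := wD_mul_wD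
    rw [weylDer_planeDer]
    exact ((hc _ _).symm).mul_right ((hD _ _).sub_left ((hc _ _).mul_left (hD _ _)))

lemma adjoin_weylLift_planeDer :
    Algebra.adjoin K
      (Set.range (weylLift (fun i => MvPolynomial.X (m.succAbove i)) (planeDer a m)) ∪
        {weylPoly K (n + 1) h, algebraMap K (Weyl K (n + 1)) (a m)⁻¹ * wD K (n + 1) m}) = ⊤ := by
  rw [eq_top_iff, ← weyl_adjoin]
  set S := Algebra.adjoin K
    (Set.range (weylLift (fun i => MvPolynomial.X (m.succAbove i)) (planeDer a m)) ∪
      {weylPoly K (n + 1) h, algebraMap K (Weyl K (n + 1)) (a m)⁻¹ * wD K (n + 1) m}) with hS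
  have hx : ∀ i, wX K (n + 1) (m.succAbove i) ∈ S := fun i =>
    Algebra.subset_adjoin (Or.inl ⟨FreeAlgebra.ι K (Sum.inl i), by simp [weylLift, weylPoly_X]⟩)
  have hT : weylPoly K (n + 1) h ∈ S := Algebra.subset_adjoin (by simp)
  have hc : ∀ c, algebraMap K (Weyl K (n + 1)) c ∈ S := S.algebraMap_mem
  have hxm : wX K (n + 1) m ∈ S := by
    have e : wX K (n + 1) m = algebraMap K _ (a m)⁻¹ * (weylPoly K (n + 1) h -
        ∑ i, algebraMap K _ (a (m.succAbove i)) * wX K (n + 1) (m.succAbove i) -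
          algebraMap K _ b) := by
      rw [weylPoly_of_eq_affine hh, Fin.sum_univ_succAbove _ m, add_assoc, add_sub_assoc,
        add_sub_assoc, add_sub_cancel_left, sub_self, add_zero, ← mul_assoc, ← map_mul,
        inv_mul_cancel₀ hm, map_one, one_mul]
    rw [e]
    exact mul_mem (hc _) (sub_mem (sub_mem hT (sum_mem fun i _ => mul_mem (hc _) (hx i))) (hc _))
  have hdm : wD K (n + 1) m ∈ S := by
    have hP : algebraMap K (Weyl K (n + 1)) (a m)⁻¹ * wD K (n + 1) m ∈ S :=
      Algebra.subset_adjoin (by simp)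
    have := mul_mem (hc (a m)) hP
    rwa [← mul_assoc, ← map_mul, mul_inv_cancel₀ hm, map_one, one_mul] at this
  have hd : ∀ i, wD K (n + 1) (m.succAbove i) ∈ S := by
    intro i
    have h1 : weylDer (planeDer a m i) ∈ S :=
      Algebra.subset_adjoin (Or.inl ⟨FreeAlgebra.ι K (Sum.inr i), by simp [weylLift]⟩)
    have := add_mem h1 (mul_mem (hc (a (m.succAbove i) / a m)) hdm)
    rwa [weylDer_planeDer, sub_add_cancel] at this
  refine Algebra.adjoin_le ?_
  rintro _ (⟨i, rfl⟩ | ⟨i, rfl⟩) <;> rcases Fin.eq_self_or_eq_succAbove m i with rfl | ⟨j, rfl⟩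
  exacts [hxm, hx j, hdm, hd j]

variable {φ : MvPolynomial (Fin (n + 1)) K →ₐ[K] MvPolynomial (Fin n) K}
  (hφ : Function.Surjective φ) (hker : RingHom.ker φ = Ideal.span {h})

include hφ hker

lemma adjoin_hyperplane_coordinates :
    Algebra.adjoin K (Set.range fun i => φ (MvPolynomial.X (m.succAbove i))) = ⊤ := by
  set S := Algebra.adjoin K (Set.range fun i => φ (MvPolynomial.X (m.succAbove i)))
  have hc : ∀ c, φ (MvPolynomial.C c) ∈ S := fun c => by
    rw [← MvPolynomial.algebraMap_eq, AlgHom.commutes]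
    exact S.algebraMap_mem c
  have hx : ∀ i, φ (MvPolynomial.X (m.succAbove i)) ∈ S :=
    fun i => Algebra.subset_adjoin ⟨i, rfl⟩
  have hφh : φ h = 0 := (RingHom.mem_ker).1 (hker ▸ Ideal.mem_span_singleton_self h)
  have hxm : φ (MvPolynomial.X m) ∈ S := by
    have e : MvPolynomial.X m = MvPolynomial.C (a m)⁻¹ * (h -
        ∑ i, MvPolynomial.C (a (m.succAbove i)) * MvPolynomial.X (m.succAbove i) -
          MvPolynomial.C b) := by
      rw [hh, Fin.sum_univ_succAbove _ m, add_assoc, add_sub_assoc,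
        add_sub_assoc, add_sub_cancel_left, sub_self, add_zero, ← mul_assoc, ← map_mul,
        inv_mul_cancel₀ hm, map_one, one_mul]
    rw [e, map_mul, map_sub, map_sub, hφh, map_sum]
    refine mul_mem (hc _) (sub_mem (sub_mem (zero_mem _) (sum_mem fun i _ => ?_)) (hc _))
    rw [map_mul]
    exact mul_mem (hc _) (hx i)
  rw [eq_top_iff]
  rintro p -
  obtain ⟨p, rfl⟩ := hφ p
  induction p using MvPolynomial.induction_on with
  | C c => exact hc c
  | add p q hp hq =>
    rw [map_add]
    exact add_mem hp hq
  | mul_X p i hp =>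
    rw [map_mul]
    refine mul_mem hp ?_
    rcases Fin.eq_self_or_eq_succAbove m i with rfl | ⟨j, rfl⟩
    exacts [hxm, hx j]

lemma exists_planeDer_quotient :
    ∃ η : Fin n → Derivation K (MvPolynomial (Fin n) K) (MvPolynomial (Fin n) K),
      ∀ i p, η i (φ p) = φ (planeDer a m i p) := by
  have hd : ∀ i p, φ p = 0 → φ (planeDer a m i p) = 0 := by
    intro i p hp
    have hφh : φ h = 0 := (RingHom.mem_ker).1 (hker ▸ Ideal.mem_span_singleton_self h)
    obtain ⟨q, rfl⟩ := Ideal.mem_span_singleton'.1 (hker ▸ (RingHom.mem_ker.2 hp))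
    rw [Derivation.leibniz, planeDer_eq_zero hh hm, smul_zero, zero_add, smul_eq_mul, map_mul,
      hφh, zero_mul]
  exact ⟨fun i => Derivation.liftOfSurjective hφ (hd i),
    fun i p => Derivation.liftOfSurjective_apply hφ (hd i) p⟩

end HyperplaneCoordinates

section CohomologyAction

variable {ι B : Type*} [CommRing B] {D : Type*} [Ring D] {g : ι → B}
  {L : Finset ι → Type*} [∀ S, CommRing (L S)] [∀ S, Algebra B (L S)]
  [∀ S, IsLocalization.Away (∏ i ∈ S, g i) (L S)] [∀ S, Module D (L S)]
  [LinearOrder ι] [Fintype ι] {hD : CechLinear D g L} {k : ℕ}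

/-- Coboundaries in degree `k`, as a submodule of the cocycles. -/
def CechLinear.coboundaries (hD : CechLinear D g L) (k : ℕ) : Submodule D (hD.cocycles k) where
  carrier := {c | ∃ b : ∀ S, L S, ∀ S : Finset ι, S.card = k → c.1 S = cechD g L b S}
  zero_mem' := ⟨0, fun S _ => by rw [map_zero]; rfl⟩
  add_mem' := by
    rintro c c' ⟨b, hb⟩ ⟨b', hb'⟩
    exact ⟨b + b', fun S hS => by
      rw [map_add, Pi.add_apply, ← hb S hS, ← hb' S hS]
      rfl⟩
  smul_mem' := by
    rintro a c ⟨b, hb⟩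
    exact ⟨a • b, fun S hS => by
      rw [hD.cechD_smul, Pi.smul_apply, ← hb S hS]
      rfl⟩

/-- The quotient of the cocycles by the coboundaries realizes the cohomology. -/
def CechLinear.quotientCohomology (hD : CechLinear D g L) (k : ℕ) :
    CechCohomology D g L hD k (hD.cocycles k ⧸ hD.coboundaries k) where
  proj := (hD.coboundaries k).mkQ
  surjective := Submodule.mkQ_surjective _
  proj_eq_zero_iff c := by
    rw [Submodule.mkQ_apply, Submodule.Quotient.mk_eq_zero]
    rfl

variable {H : Type*} [AddCommGroup H] [Module D H]
  {T : D} {t : B} (hT : ∀ S (x : L S), T • x = t • x)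

include hT

omit [LinearOrder ι] [Fintype ι] in
lemma pow_smul_of_smul_eq (N : ℕ) (S : Finset ι) (x : L S) : T ^ N • x = t ^ N • x := by
  induction N generalizing x with
  | zero => simp
  | succ N ih => rw [pow_succ, mul_smul, hT, ih, pow_succ, mul_smul]

lemma CechCohomology.exists_pow_smul_eq_zero (hH : CechCohomology D g L hD k H)
    (ht : t ∈ Ideal.span (Set.range g)) (x : H) : ∃ N : ℕ, T ^ N • x = 0 := by
  obtain ⟨c, rfl⟩ := hH.surjective x
  obtain ⟨N, b, -, hb⟩ := exists_primitive_of_mem_span g L (fun _ => True)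
    (Finset.Subset.refl Finset.univ) (fun S h => absurd trivial h) c.2 (fun _ _ _ _ => trivial)
    (by simpa using ht)
  refine ⟨N, ?_⟩
  rw [← map_smul, hH.proj_eq_zero_iff]
  refine ⟨b, fun S hS => ?_⟩
  rw [hb S (Finset.subset_univ S) hS]
  exact pow_smul_of_smul_eq hT N S _

lemma CechCohomology.subsingleton_of_card_eq_zero (hH : CechCohomology D g L hD 0 H)
    (ht : t ∈ Ideal.span (Set.range g)) (hreg : ∀ S (x : L S), t • x = 0 → x = 0) :
    Subsingleton H := by
  refine subsingleton_of_forall_eq 0 fun x => ?_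
  obtain ⟨c, rfl⟩ := hH.surjective x
  obtain ⟨N, hN⟩ := hH.exists_pow_smul_eq_zero hT ht (hH.proj c)
  rw [← map_smul, hH.proj_eq_zero_iff] at hN
  obtain ⟨b, hb⟩ := hN
  rw [hH.proj_eq_zero_iff]
  refine ⟨0, fun S hS => ?_⟩
  have h1 : t ^ N • c.1 S = 0 := by
    rw [← pow_smul_of_smul_eq hT, ← cechD_of_card_eq_zero g L b hS]
    exact hb S hS
  have h2 : c.1 S = 0 := by
    clear hb
    induction N with
    | zero => simpa using h1
    | succ N ih => exact ih (hreg S _ (by rw [smul_smul, ← pow_succ', h1]))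
  rw [h2, cechD_of_card_eq_zero g L 0 hS]

lemma CechCohomology.exists_eq_smul_add (hH : CechCohomology D g L hD k H)
    (hdiv : ∀ x : H, ∃ y, T • y = x) {c : ∀ S, L S} (hc : c ∈ hD.cocycles k) :
    ∃ w b : ∀ S, L S, ∀ S : Finset ι, S.card = k → c S = t • w S + cechD g L b S := by
  obtain ⟨y, hy⟩ := hdiv (hH.proj ⟨c, hc⟩)
  obtain ⟨w, rfl⟩ := hH.surjective y
  rw [← map_smul, eq_comm, ← sub_eq_zero, ← map_sub, hH.proj_eq_zero_iff] at hy
  obtain ⟨b, hb⟩ := hy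
  refine ⟨w.1, b, fun S hS => ?_⟩
  rw [← hb S hS, ← hT]
  exact (add_sub_cancel _ _).symm

lemma CechCohomology.smul_proj_eq_zero_iff (hH : CechCohomology D g L hD k H)
    (c : hD.cocycles k) : T • hH.proj c = 0 ↔
      ∃ b : ∀ S, L S, ∀ S : Finset ι, S.card = k → cechD g L b S = t • c.1 S := by
  rw [← map_smul, hH.proj_eq_zero_iff]
  refine exists_congr fun b => forall₂_congr fun S _ => ?_
  rw [eq_comm, ← hT]
  rfl

end CohomologyAction

section GeneratorIndependence

variable {K : Type*} [Field K] {I J B ι κ : Type*} [CommRing B] [Algebra K B] {x : I → B}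
  {η : J → Derivation K B B}
  [LinearOrder ι] [Fintype ι] [LinearOrder κ] [Fintype κ] {g : ι → B} {g' : κ → B}
  {L : Finset ι → Type*} [∀ S, CommRing (L S)] [∀ S, Algebra B (L S)]
  [∀ S, IsLocalization.Away (∏ i ∈ S, g i) (L S)] [∀ S, Module (FreeAlgebra K (I ⊕ J)) (L S)]
  {L' : Finset κ → Type*} [∀ S, CommRing (L' S)] [∀ S, Algebra B (L' S)]
  [∀ S, IsLocalization.Away (∏ i ∈ S, g' i) (L' S)] [∀ S, Module (FreeAlgebra K (I ⊕ J)) (L' S)]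

lemma CechCohomology.nonempty_of_comp_embedding (j : κ ↪o ι) (hj : ∀ l, g (j l) = g' l)
    (hg : ∀ i, g i ∈ Ideal.span (Set.range g'))
    (hL : ∀ S, DerActs K x (fun j => η j) (L S)) (hL' : ∀ S, DerActs K x (fun j => η j) (L' S))
    {hD : CechLinear (FreeAlgebra K (I ⊕ J)) g L} {hD' : CechLinear (FreeAlgebra K (I ⊕ J)) g' L'}
    {k : ℕ} {H : Type*} [AddCommGroup H] [Module (FreeAlgebra K (I ⊕ J)) H]
    (h : CechCohomology (FreeAlgebra K (I ⊕ J)) g' L' hD' k H) :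
    Nonempty (CechCohomology (FreeAlgebra K (I ⊕ J)) g L hD k H) := by
  have hprod : ∀ S : Finset κ, ∏ i ∈ S.map j.toEmbedding, g i = ∏ i ∈ S, g' i := fun S => by
    rw [Finset.prod_map]
    exact Finset.prod_congr rfl fun l _ => hj l
  have (S : Finset κ) : IsLocalization.Away (∏ i ∈ S.map j.toEmbedding, g i) (L' S) := by
    rw [hprod]
    infer_instance
  let f : ∀ S : Finset κ, L (S.map j.toEmbedding) ≃ₐ[B] L' S := fun S =>
    IsLocalization.algEquiv (Submonoid.powers (∏ i ∈ S.map j.toEmbedding, g i)) _ _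
  refine CechCohomology.nonempty_of_restrict j (fun S => (f S).toAlgHom)
    (fun S => (f S).bijective) (fun S a y => ?_) (fun i => ?_) h
  · exact (hL _).map_smul (hL' S) (Submonoid.powers (∏ i ∈ S.map j.toEmbedding, g i))
      (AlgHom.id K B) (fun _ => rfl) (fun _ _ => rfl) ((f S).toAlgHom : _ →+* _)
      (fun b => (f S).commutes b) a y
  · simpa only [hj] using hg i

/-- Čech cohomology depends only on the ideal spanned by the family. -/
lemma CechCohomology.nonempty_linearEquiv_of_span_eq
    (hspan : Ideal.span (Set.range g) = Ideal.span (Set.range g'))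
    (hL : ∀ S, DerActs K x (fun j => η j) (L S)) (hL' : ∀ S, DerActs K x (fun j => η j) (L' S))
    {hD : CechLinear (FreeAlgebra K (I ⊕ J)) g L} {hD' : CechLinear (FreeAlgebra K (I ⊕ J)) g' L'}
    {k : ℕ} {H H' : Type*} [AddCommGroup H] [Module (FreeAlgebra K (I ⊕ J)) H]
    [AddCommGroup H'] [Module (FreeAlgebra K (I ⊕ J)) H']
    (h : CechCohomology (FreeAlgebra K (I ⊕ J)) g L hD k H)
    (h' : CechCohomology (FreeAlgebra K (I ⊕ J)) g' L' hD' k H') :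
    Nonempty (H ≃ₗ[FreeAlgebra K (I ⊕ J)] H') := by
  let G : ι ⊕ₗ κ → B := fun s => Sum.elim g g' (ofLex s)
  have hG : ∀ s, G s ∈ Ideal.span (Set.range g) := by
    intro s
    rcases hs : ofLex s with i | l
    · exact Ideal.subset_span ⟨i, by simp [G, hs]⟩
    · rw [hspan]
      exact Ideal.subset_span ⟨l, by simp [G, hs]⟩
  choose mod hmod using fun S : Finset (ι ⊕ₗ κ) => exists_derActs x η
    (Localization.Away (∏ s ∈ S, G s)) (Submonoid.powers (∏ s ∈ S, G s))
  have hlin : CechLinear (FreeAlgebra K (I ⊕ J)) G fun S => Localization.Away (∏ s ∈ S, G s) :=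
    DerActs.cechLinear hmod
  let e₁ : ι ↪o ι ⊕ₗ κ := OrderEmbedding.ofStrictMono Sum.inlₗ Sum.Lex.inl_strictMono
  let e₂ : κ ↪o ι ⊕ₗ κ := OrderEmbedding.ofStrictMono Sum.inrₗ Sum.Lex.inr_strictMono
  have he₁ : ∀ i, G (e₁ i) = g i := fun _ => rfl
  have he₂ : ∀ l, G (e₂ l) = g' l := fun _ => rfl
  clear_value G e₁ e₂
  obtain ⟨h₁⟩ := CechCohomology.nonempty_of_comp_embedding (hD := hlin) e₁ he₁ hG hmod hL h
  obtain ⟨h₂⟩ := CechCohomology.nonempty_of_comp_embedding (hD := hlin) e₂ he₂ (hspan ▸ hG) hmod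
    hL' h'
  exact CechCohomology.nonempty_linearEquiv h₁ h₂

end GeneratorIndependence

section Length

lemma mlength_congr {A M N : Type} [Ring A] [AddCommGroup M] [Module A M] [AddCommGroup N]
    [Module A N] (f : M ≃ₗ[A] N) : mlength A M = mlength A N :=
  Order.krullDim_eq_of_orderIso (Submodule.orderIsoMapComap f)

lemma mlength_eq_zero_of_subsingleton {A M : Type} [Ring A] [AddCommGroup M] [Module A M]
    [Subsingleton M] : mlength A M = 0 :=
  Order.krullDim_eq_zero_of_unique

lemma mlength_eq_of_surjective {A D M : Type} [Ring A] [Ring D] [AddCommGroup M] [Module A M]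
    [Module D M] (θ : D →+* A) (hs : Function.Surjective θ) (hθ : ∀ a (m : M), a • m = θ a • m) :
    mlength D M = mlength A M :=
  Order.krullDim_eq_of_orderIso <| Equiv.toOrderIso
    { toFun := fun N =>
        { N.toAddSubmonoid with
          smul_mem' := fun a m hm => by
            obtain ⟨a, rfl⟩ := hs a
            rw [← hθ]
            exact N.smul_mem a hm }
      invFun := fun N =>
        { N.toAddSubmonoid with
          smul_mem' := fun a m hm => by
            rw [hθ]
            exact N.smul_mem _ hm }
      left_inv := fun _ => rfl
      right_inv := fun _ => rfl } (fun _ _ h => h) fun _ _ h => h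

end Length

section HyperplaneSection

variable {K : Type} [Field K] [CharZero K] {n : ℕ} {a : Fin (n + 1) → K} {m : Fin (n + 1)} {b : K}
  {h : MvPolynomial (Fin (n + 1)) K}
  {φ : MvPolynomial (Fin (n + 1)) K →ₐ[K] MvPolynomial (Fin n) K}
  {r r' : ℕ} {g : Fin r → MvPolynomial (Fin (n + 1)) K} {g' : Fin r' → MvPolynomial (Fin n) K}
  [∀ S : Finset (Fin r), Module (Weyl K (n + 1)) (Localization.Away (∏ i ∈ S, g i))]
  [∀ S : Finset (Fin r), IsScalarTower K (Weyl K (n + 1)) (Localization.Away (∏ i ∈ S, g i))]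
  [∀ S : Finset (Fin r'), Module (Weyl K n) (Localization.Away (∏ i ∈ S, g' i))]
  [∀ S : Finset (Fin r'), IsScalarTower K (Weyl K n) (Localization.Away (∏ i ∈ S, g' i))]

lemma mlength_eq_of_hyperplane (hh : h = ∑ i, MvPolynomial.C (a i) * MvPolynomial.X i +
      MvPolynomial.C b) (hm : a m ≠ 0)
    (hφ : Function.Surjective φ) (hker : RingHom.ker φ = Ideal.span {h})
    (hmem : h ∈ Ideal.span (Set.range g))
    (hspan : Ideal.span (Set.range fun i => φ (g i)) = Ideal.span (Set.range g'))
    (hnat : ∀ S : Finset (Fin r), NatActs K (n + 1) (∏ i ∈ S, g i))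
    (hnat' : ∀ S : Finset (Fin r'), NatActs K n (∏ i ∈ S, g' i))
    {k : ℕ} {H H' : Type} [AddCommGroup H] [Module (Weyl K (n + 1)) H]
    [AddCommGroup H'] [Module (Weyl K n) H']
    (hH : CechCohomology (Weyl K (n + 1)) g (fun S => Localization.Away (∏ i ∈ S, g i))
      (NatActs.cechLinear hnat) (k + 1) H)
    (hH' : CechCohomology (Weyl K n) g' (fun S => Localization.Away (∏ i ∈ S, g' i))
      (NatActs.cechLinear hnat') k H') :
    mlength (Weyl K (n + 1)) H = mlength (Weyl K n) H' := by
  have hne : h ≠ 0 := by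
    rintro rfl
    have h0 := pderiv_of_eq_affine hh m
    rw [map_zero, eq_comm, ← map_zero MvPolynomial.C] at h0
    exact hm (MvPolynomial.C_injective _ _ h0)
  obtain ⟨η, hη⟩ := exists_planeDer_quotient hh hm hφ hker
  let x : Fin n → MvPolynomial (Fin (n + 1)) K := fun i => MvPolynomial.X (m.succAbove i)
  let z : Fin n → MvPolynomial (Fin n) K := fun i => φ (x i)
  let θ := weylLift x (planeDer a m)
  let θ' := weylLift z η
  have hθ' : Function.Surjective θ' := by
    refine weylLift_surjective z η (adjoin_hyperplane_coordinates hh hm hφ hker) fun i j => ?_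
    rw [hη, planeDer_X]
    split_ifs <;> simp
  -- the operators along the hyperplane act on all modules
  let _ (S : Finset (Fin r)) : Module (FreeAlgebra K (Fin n ⊕ Fin n))
    (Localization.Away (∏ i ∈ S, g i)) := Module.compHom _ θ.toRingHom
  let _ : Module (FreeAlgebra K (Fin n ⊕ Fin n)) H := Module.compHom _ θ.toRingHom
  let _ (S : Finset (Fin r')) : Module (FreeAlgebra K (Fin n ⊕ Fin n))
    (Localization.Away (∏ i ∈ S, g' i)) := Module.compHom _ θ'.toRingHom
  let _ : Module (FreeAlgebra K (Fin n ⊕ Fin n)) H' := Module.compHom _ θ'.toRingHom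
  have hact (S : Finset (Fin r)) : DerActs K x (fun j => planeDer a m j)
      (Localization.Away (∏ i ∈ S, g i)) := (hnat S).derActs x (planeDer a m) fun _ _ => rfl
  have hact' (S : Finset (Fin r')) : DerActs K z (fun j => η j)
      (Localization.Away (∏ i ∈ S, g' i)) := (hnat' S).derActs z η fun _ _ => rfl
  choose mod hmod using fun S : Finset (Fin r) => exists_derActs z η
    (Localization.Away (∏ i ∈ S, φ (g i))) (Submonoid.powers (∏ i ∈ S, φ (g i)))
  have hlin : CechLinear (FreeAlgebra K (Fin n ⊕ Fin n)) g
      fun S => Localization.Away (∏ i ∈ S, g i) := DerActs.cechLinear hact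
  have hlin' : CechLinear (FreeAlgebra K (Fin n ⊕ Fin n)) g'
      fun S => Localization.Away (∏ i ∈ S, g' i) := DerActs.cechLinear hact'
  have hlinφ : CechLinear (FreeAlgebra K (Fin n ⊕ Fin n)) (fun i => φ (g i))
      fun S => Localization.Away (∏ i ∈ S, φ (g i)) := DerActs.cechLinear hmod
  -- change of generators downstairs
  obtain ⟨eH⟩ := CechCohomology.nonempty_linearEquiv_of_span_eq hspan hmod hact'
    (hlinφ.quotientCohomology k)
    (hH'.compHom hlin' θ'.toRingHom (fun _ _ _ => rfl) fun _ _ => rfl)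
  -- the operator `h` upstairs
  have hTP := inv_wD_mul_weylPoly hh hm
  have hT : ∀ (S : Finset (Fin r)) (y : Localization.Away (∏ i ∈ S, g i)),
    weylPoly K (n + 1) h • y = h • y := fun S y => (hnat S).weylPoly_smul h y
  have hθT : ∀ q, Commute (θ q) (weylPoly K (n + 1) h) :=
    commute_weylLift_planeDer_weylPoly hh hm
  have htor := hH.exists_pow_smul_eq_zero hT hmem
  let hH0 := (NatActs.cechLinear hnat).quotientCohomology k
  have hdiv := exists_smul_eq_of_torsion K hTP (hH0.exists_pow_smul_eq_zero hT hmem)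
  have hprod (S : Finset (Fin r)) : ∏ i ∈ S, φ (g i) = φ (∏ i ∈ S, g i) := (map_prod φ g S).symm
  choose p hp hps hpk using fun S : Finset (Fin r) => exists_awayMap_of_surjective
    (L := Localization.Away (∏ i ∈ S, g i)) (L' := Localization.Away (∏ i ∈ S, φ (g i)))
    (φ : MvPolynomial (Fin (n + 1)) K →+* MvPolynomial (Fin n) K) (∏ i ∈ S, g i)
    (∏ i ∈ S, φ (g i)) (hprod S) hφ (t := h) hker
  obtain ⟨eK⟩ := CechCohomology.nonempty_ker_linearEquiv p hp hps hpk
    (fun S q y => (hact S).map_smul (hmod S) (Submonoid.powers (∏ i ∈ S, g i)) φ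
      (fun _ => rfl) (fun j b => (hη j b).symm) (p S) (hp S) q y)
    (fun S q y => by
      rw [← hT, ← hT]
      change θ q • weylPoly K (n + 1) h • y = weylPoly K (n + 1) h • θ q • y
      rw [smul_smul, smul_smul, (hθT q).eq])
    (fun S y => eq_zero_of_smul_eq_zero_of_isLocalization
      (Submonoid.powers (∏ i ∈ S, g i)) hne)
    (fun c hc => hH0.exists_eq_smul_add hT hdiv hc)
    (hH.compHom hlin θ.toRingHom (fun _ _ _ => rfl) fun _ _ => rfl)
    (hlinφ.quotientCohomology k)
    (kerSMul (weylPoly K (n + 1) h) θ (M := H) (fun _ _ => rfl) hθT)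
    (fun c => hH.smul_proj_eq_zero_iff hT ⟨c.1, c.2⟩)
  calc mlength (Weyl K (n + 1)) H
      = mlength (FreeAlgebra K (Fin n ⊕ Fin n))
          (kerSMul (weylPoly K (n + 1) h) θ (M := H) (fun _ _ => rfl) hθT) :=
        Order.krullDim_eq_of_orderIso (submoduleOrderIsoKerSMul θ (fun _ _ => rfl) hθT hTP
          (commute_weylLift_planeDer_wD _) (adjoin_weylLift_planeDer hh hm) htor)
    _ = mlength (FreeAlgebra K (Fin n ⊕ Fin n)) H' := mlength_congr (eK.trans eH)
    _ = mlength (Weyl K n) H' := mlength_eq_of_surjective θ'.toRingHom hθ' fun _ _ => rfl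

end HyperplaneSection

/-- For a degree-one polynomial `h₀` and an ideal `I` of
`R = K[x₁,…,x_{n+1}]`, with `R' = R/(h₀) ≅ K[x₁,…,x_n]` and
`I' = (I + Rh₀)/Rh₀`, the length of `H^i_{I+Rh₀}(R)` over `D_{n+1}` equals the
length of `H^{i-1}_{I'}(R')` over `D_n`, for every `i` (for `i = 0` the right
hand side is `H^{-1} = 0`).  Local cohomology is realized via the Čech complex
of a finite family of generators, each localization carrying its natural
Weyl-algebra module structure. -/
theorem length_localCohomology_hyperplane_section
    (K : Type) [Field K] [CharZero K] (n' : ℕ)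
    (h₀ : MvPolynomial (Fin (n' + 1)) K) (hdeg : h₀.totalDegree = 1)
    (I : Ideal (MvPolynomial (Fin (n' + 1)) K))
    (e : (MvPolynomial (Fin (n' + 1)) K ⧸ Ideal.span {h₀}) ≃ₐ[K]
      MvPolynomial (Fin n') K)
    (I' : Ideal (MvPolynomial (Fin n') K))
    (hI' : I' = Ideal.map ((e : (MvPolynomial (Fin (n' + 1)) K ⧸
        Ideal.span {h₀}) →+* MvPolynomial (Fin n') K).comp
        (Ideal.Quotient.mk (Ideal.span {h₀}))) I)
    -- Čech data for `I + Rh₀` upstairs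
    (r : ℕ) (g : Fin r → MvPolynomial (Fin (n' + 1)) K)
    (hg : Ideal.span (Set.range g) = I ⊔ Ideal.span {h₀})
    [∀ S : Finset (Fin r),
      Module (Weyl K (n' + 1)) (Localization.Away (∏ i ∈ S, g i))]
    [∀ S : Finset (Fin r),
      IsScalarTower K (Weyl K (n' + 1)) (Localization.Away (∏ i ∈ S, g i))]
    (hnat : ∀ S : Finset (Fin r), NatActs K (n' + 1) (∏ i ∈ S, g i))
    (ψ : ∀ S T : Finset (Fin r), S ⊆ T →
      (Localization.Away (∏ i ∈ S, g i) →ₐ[MvPolynomial (Fin (n' + 1)) K]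
        Localization.Away (∏ i ∈ T, g i)))
    (d : ∀ k : ℕ, Cochain K (n' + 1) r g k →ₗ[Weyl K (n' + 1)]
      Cochain K (n' + 1) r g (k + 1))
    (hd : IsCechDiff K (n' + 1) r g ψ d)
    -- Čech data for `I'` downstairs
    (r' : ℕ) (g' : Fin r' → MvPolynomial (Fin n') K)
    (hg' : Ideal.span (Set.range g') = I')
    [∀ S : Finset (Fin r'),
      Module (Weyl K n') (Localization.Away (∏ i ∈ S, g' i))]
    [∀ S : Finset (Fin r'),
      IsScalarTower K (Weyl K n') (Localization.Away (∏ i ∈ S, g' i))]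
    (hnat' : ∀ S : Finset (Fin r'), NatActs K n' (∏ i ∈ S, g' i))
    (ψ' : ∀ S T : Finset (Fin r'), S ⊆ T →
      (Localization.Away (∏ i ∈ S, g' i) →ₐ[MvPolynomial (Fin n') K]
        Localization.Away (∏ i ∈ T, g' i)))
    (d' : ∀ k : ℕ, Cochain K n' r' g' k →ₗ[Weyl K n']
      Cochain K n' r' g' (k + 1))
    (hd' : IsCechDiff K n' r' g' ψ' d')
    -- realizations of the local cohomology modules
    (H : ℕ → Type) [∀ i, AddCommGroup (H i)]
    [∀ i, Module (Weyl K (n' + 1)) (H i)]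
    (π : ∀ i, LinearMap.ker (d i) →ₗ[Weyl K (n' + 1)] H i)
    (hπ : ∀ i, IsCechCoh K (n' + 1) r g d i (H i) (π i))
    (H' : ℕ → Type) [∀ i, AddCommGroup (H' i)]
    [∀ i, Module (Weyl K n') (H' i)]
    (π' : ∀ i, LinearMap.ker (d' i) →ₗ[Weyl K n'] H' i)
    (hπ' : ∀ i, IsCechCoh K n' r' g' d' i (H' i) (π' i)) :
    mlength (Weyl K (n' + 1)) (H 0) = 0 ∧
    ∀ i : ℕ, mlength (Weyl K (n' + 1)) (H (i + 1)) =
      mlength (Weyl K n') (H' i) := by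
  obtain ⟨a, b, hh⟩ := eq_affine_of_totalDegree_le_one hdeg.le
  obtain ⟨m, hm⟩ : ∃ m, a m ≠ 0 := by
    by_contra! ha
    simp [hh, ha] at hdeg
  let φ : MvPolynomial (Fin (n' + 1)) K →ₐ[K] MvPolynomial (Fin n') K :=
    (e : _ →ₐ[K] MvPolynomial (Fin n') K).comp (Ideal.Quotient.mkₐ K (Ideal.span {h₀}))
  have hφ : Function.Surjective φ := e.surjective.comp Ideal.Quotient.mk_surjective
  have hker : RingHom.ker φ = Ideal.span {h₀} := by
    ext p
    change e (Ideal.Quotient.mk _ p) = 0 ↔ _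
    rw [EmbeddingLike.map_eq_zero_iff, Ideal.Quotient.eq_zero_iff_mem]
  have hmem : h₀ ∈ Ideal.span (Set.range g) :=
    hg ▸ Ideal.mem_sup_right (Ideal.mem_span_singleton_self h₀)
  have hspan : Ideal.span (Set.range fun i => φ (g i)) = Ideal.span (Set.range g') := by
    have h1 : Ideal.map φ (Ideal.span {h₀}) = ⊥ := by
      rw [Ideal.map_eq_bot_iff_le_ker, hker]
    have h2 : Ideal.map φ (Ideal.span (Set.range g)) = Ideal.map φ I := by
      rw [hg, Ideal.map_sup, h1, sup_bot_eq]
    rw [hg', hI', Set.range_comp' φ g, ← Ideal.map_span, h2]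
    rfl
  have hne : h₀ ≠ 0 := by
    rintro rfl
    simp at hdeg
  refine ⟨?_, fun i => ?_⟩
  · obtain ⟨hH⟩ := nonempty_cechCohomology hd (hπ 0) (NatActs.cechLinear hnat)
    have := hH.subsingleton_of_card_eq_zero (fun S y => (hnat S).weylPoly_smul h₀ y) hmem
      fun S y => eq_zero_of_smul_eq_zero_of_isLocalization
        (Submonoid.powers (∏ i ∈ S, g i)) hne
    exact mlength_eq_zero_of_subsingleton
  · obtain ⟨hH⟩ := nonempty_cechCohomology hd (hπ (i + 1)) (NatActs.cechLinear hnat)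
    obtain ⟨hH'⟩ := nonempty_cechCohomology hd' (hπ' i) (NatActs.cechLinear hnat')
    exact mlength_eq_of_hyperplane hh hm hφ hker hmem hspan hnat hnat' hH hH'
end

section
/- Additivity of multiplicity: If 0 → N → M → L → 0 is a short exact sequence of holonomic left D_n-modules, then mult M = mult N + mult L. -/
open Polynomial MvPolynomial

section WeylAlgebra

variable (K : Type) [Field K] (n : ℕ)

/-- The generators of the Weyl algebra, indexed as in `WeylRel`. -/
noncomputable def weylGen (s : Fin n ⊕ Fin n) : Weyl K n :=
  RingQuot.mkAlgHom K (WeylRel K n) (FreeAlgebra.ι K s)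

/-- The span of `1` and the generators of the Weyl algebra. -/
noncomputable def weylGenSpan : Submodule K (Weyl K n) :=
  Submodule.span K (insert 1 (Set.range (weylGen K n)))

/-- The generators in the order in which they occur in a normally ordered monomial. -/
def normalOrder : List (Fin n ⊕ Fin n) :=
  (List.finRange n).map Sum.inl ++ (List.finRange n).map Sum.inr

/-- The normally ordered monomial `x^α ∂^β`. -/
noncomputable def normalMonomial (a : Fin n ⊕ Fin n →₀ ℕ) : Weyl K n :=
  ((normalOrder n).map fun s => weylGen K n s ^ a s).prod

/-- The linear map sending a commutative monomial to the normally ordered one. -/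
noncomputable def quantize : MvPolynomial (Fin n ⊕ Fin n) K →ₗ[K] Weyl K n :=
  (MvPolynomial.basisMonomials (Fin n ⊕ Fin n) K).constr K (normalMonomial K n)

theorem quantize_monomial (a : Fin n ⊕ Fin n →₀ ℕ) (r : K) :
    quantize K n (MvPolynomial.monomial a r) = r • normalMonomial K n a := by
  have h : quantize K n (MvPolynomial.monomial a 1) = normalMonomial K n a := by
    simpa [quantize] using (MvPolynomial.basisMonomials (Fin n ⊕ Fin n) K).constr_basis K
      (normalMonomial K n) a
  rw [← h, ← map_smul, MvPolynomial.smul_monomial, smul_eq_mul, mul_one]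

theorem nodup_normalOrder : (normalOrder n).Nodup := by
  refine List.Nodup.append ((List.nodup_finRange n).map Sum.inl_injective)
    ((List.nodup_finRange n).map Sum.inr_injective) ?_
  intro s hs ht
  simp only [List.mem_map] at hs ht
  obtain ⟨i, -, rfl⟩ := hs
  obtain ⟨j, -, h⟩ := ht
  exact Sum.inr_ne_inl h

theorem mem_normalOrder (s : Fin n ⊕ Fin n) : s ∈ normalOrder n := by
  rcases s with i | i <;> simp [normalOrder]

theorem sum_map_normalOrder (f : Fin n ⊕ Fin n → ℕ) :
    ((normalOrder n).map f).sum = ∑ i, f (Sum.inl i) + ∑ i, f (Sum.inr i) := by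
  simp only [normalOrder, List.map_append, List.map_map, List.sum_append]
  rw [← List.sum_ofFn, ← List.sum_ofFn, List.ofFn_eq_map, List.ofFn_eq_map]
  rfl

theorem sum_map_normalOrder_eq_degree (a : Fin n ⊕ Fin n →₀ ℕ) :
    ((normalOrder n).map a).sum = a.degree := by
  rw [sum_map_normalOrder, Finsupp.degree_eq_sum, Fintype.sum_sum_type]

theorem normalMonomial_eq (a : Fin n ⊕ Fin n →₀ ℕ) :
    normalMonomial K n a =
      ((List.finRange n).map fun i => wX K n i ^ a (Sum.inl i)).prod *
        ((List.finRange n).map fun i => wD K n i ^ a (Sum.inr i)).prod := by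
  simp only [normalMonomial, normalOrder, List.map_append, List.map_map, List.prod_append]
  rfl

theorem bernsteinF_eq_span_normalMonomial (k : ℤ) :
    bernsteinF K n k =
      Submodule.span K (normalMonomial K n '' {a | (a.degree : ℤ) ≤ k}) := by
  unfold bernsteinF
  congr 1
  ext w
  constructor
  · rintro ⟨α, β, h, rfl⟩
    refine ⟨Finsupp.equivFunOnFinite.symm (Sum.elim α β), ?_, ?_⟩
    · rw [Set.mem_ofPred_eq, ← sum_map_normalOrder_eq_degree, sum_map_normalOrder]
      simpa using h
    · rw [normalMonomial_eq]
      simp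
  · rintro ⟨a, h, rfl⟩
    refine ⟨fun i => a (Sum.inl i), fun i => a (Sum.inr i), ?_, normalMonomial_eq K n a⟩
    rw [Set.mem_ofPred_eq, ← sum_map_normalOrder_eq_degree, sum_map_normalOrder] at h
    exact_mod_cast h

theorem normalMonomial_mem_bernsteinF {k : ℤ} {a : Fin n ⊕ Fin n →₀ ℕ} (h : (a.degree : ℤ) ≤ k) :
    normalMonomial K n a ∈ bernsteinF K n k := by
  rw [bernsteinF_eq_span_normalMonomial]
  exact Submodule.subset_span ⟨a, h, rfl⟩

theorem one_mem_bernsteinF {k : ℤ} (hk : 0 ≤ k) : 1 ∈ bernsteinF K n k := by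
  simpa [normalMonomial] using
    normalMonomial_mem_bernsteinF K n (k := k) (a := 0) (by simpa using hk)

theorem weylGen_mem_bernsteinF (s : Fin n ⊕ Fin n) : weylGen K n s ∈ bernsteinF K n 1 := by
  let _ : BEq (Fin n ⊕ Fin n) := instBEqOfDecidableEq
  have h : normalMonomial K n (Finsupp.single s 1) = weylGen K n s := by
    unfold normalMonomial
    rw [List.prod_map_eq_pow_single s]
    · rw [Finsupp.single_eq_same, pow_one, (nodup_normalOrder n).count,
        if_pos (mem_normalOrder n s), pow_one]
    · intro t ht _
      simp [Finsupp.single_eq_of_ne ht]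
  rw [← h]
  exact normalMonomial_mem_bernsteinF K n (by simp)

theorem weylGenSpan_le_bernsteinF : weylGenSpan K n ≤ bernsteinF K n 1 := by
  refine Submodule.span_le.2 (Set.insert_subset (one_mem_bernsteinF K n zero_le_one) ?_)
  rintro _ ⟨s, rfl⟩
  exact weylGen_mem_bernsteinF K n s

theorem one_mem_weylGenSpan : 1 ∈ weylGenSpan K n :=
  Submodule.subset_span (Set.mem_insert _ _)

theorem weylGen_mem_weylGenSpan (s : Fin n ⊕ Fin n) : weylGen K n s ∈ weylGenSpan K n :=
  Submodule.subset_span (Set.mem_insert_of_mem _ ⟨s, rfl⟩)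

theorem weylGen_commutator_mem (s t : Fin n ⊕ Fin n) :
    weylGen K n s * weylGen K n t - weylGen K n t * weylGen K n s ∈ weylGenSpan K n := by
  have key {a b : FreeAlgebra K (Fin n ⊕ Fin n)} (h : WeylRel K n a b) :=
    RingQuot.mkAlgHom_rel K h
  have dx (i j : Fin n) : weylGen K n (Sum.inr i) * weylGen K n (Sum.inl j) =
      weylGen K n (Sum.inl j) * weylGen K n (Sum.inr i) + if i = j then 1 else 0 := by
    have := key (WeylRel.dx i j)
    rw [map_add, map_mul, map_mul] at this
    rw [weylGen, weylGen, this]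
    split_ifs <;> simp
  have hite (i j : Fin n) : (if i = j then 1 else 0) ∈ weylGenSpan K n := by
    split_ifs
    · exact one_mem_weylGenSpan K n
    · exact zero_mem _
  rcases s with i | i <;> rcases t with j | j
  · have := key (WeylRel.xx i j)
    rw [map_mul, map_mul] at this
    simp [weylGen, this]
  · rw [dx, sub_add_cancel_left]
    exact neg_mem (hite j i)
  · rw [dx, add_sub_cancel_left]
    exact hite i j
  · have := key (WeylRel.dd i j)
    rw [map_mul, map_mul] at this
    simp [weylGen, this]

theorem weylGen_commutator_mem_of_mem (s : Fin n ⊕ Fin n) {w : Weyl K n}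
    (hw : w ∈ weylGenSpan K n) :
    weylGen K n s * w - w * weylGen K n s ∈ weylGenSpan K n := by
  induction hw using Submodule.span_induction with
  | mem w hw =>
    rcases hw with rfl | ⟨t, rfl⟩
    · simp
    · exact weylGen_commutator_mem K n s t
  | zero => simp
  | add x y _ _ hx hy =>
    convert add_mem hx hy using 1
    noncomm_ring
  | smul r x _ hx =>
    convert Submodule.smul_mem _ r hx using 1
    rw [mul_smul_comm, smul_mul_assoc, smul_sub]

theorem weylGen_commutator_mem_pow (s : Fin n ⊕ Fin n) {w : Weyl K n} {k : ℕ}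
    (hw : w ∈ weylGenSpan K n ^ k) :
    weylGen K n s * w - w * weylGen K n s ∈ weylGenSpan K n ^ k := by
  induction hw using Submodule.pow_induction_on_left' with
  | algebraMap r => simp [Algebra.commutes r (weylGen K n s)]
  | add x y i _ _ hx hy =>
    convert add_mem hx hy using 1
    noncomm_ring
  | mem_mul m hm i x hx ih =>
    rw [pow_succ']
    convert add_mem (Submodule.mul_mem_mul (weylGen_commutator_mem_of_mem K n s hm) hx)
      (Submodule.mul_mem_mul hm ih) using 1
    simp only [mul_sub, sub_mul, mul_assoc]
    abel

theorem prod_pow_mem_weylGenSpan_pow (l : List (Fin n ⊕ Fin n)) (a : Fin n ⊕ Fin n → ℕ) :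
    (l.map fun s => weylGen K n s ^ a s).prod ∈ weylGenSpan K n ^ (l.map a).sum := by
  induction l with
  | nil => exact Submodule.one_le.1 (pow_zero (weylGenSpan K n)).ge
  | cons s l ih =>
    simp only [List.map_cons, List.prod_cons, List.sum_cons, pow_add]
    exact Submodule.mul_mem_mul
      (Submodule.pow_mem_pow _ (weylGen_mem_weylGenSpan K n s) _) ih

theorem prod_pow_add_single_sub_mem (s : Fin n ⊕ Fin n) (a : Fin n ⊕ Fin n →₀ ℕ)
    (l : List (Fin n ⊕ Fin n)) (hl : l.Nodup) (hs : s ∈ l) :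
    (l.map fun t => weylGen K n t ^ (a t + Finsupp.single s 1 t)).prod -
      weylGen K n s * (l.map fun t => weylGen K n t ^ a t).prod ∈
        weylGenSpan K n ^ (l.map a).sum := by
  induction l with
  | nil => simp at hs
  | cons t l ih =>
    rw [List.nodup_cons] at hl
    simp only [List.map_cons, List.prod_cons, List.sum_cons]
    by_cases hst : t = s
    · subst hst
      have : (l.map fun u => weylGen K n u ^ (a u + Finsupp.single t 1 u)) =
          l.map fun u => weylGen K n u ^ a u := by
        refine List.map_congr_left fun u hu => ?_
        have : u ≠ t := fun h => hl.1 (h ▸ hu)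
        simp [Finsupp.single_eq_of_ne this]
      rw [this]
      simp [pow_succ', mul_assoc]
    · have hs' : s ∈ l := by
        rcases List.mem_cons.1 hs with h | h
        · exact absurd h.symm hst
        · exact h
      have h₁ := Submodule.mul_mem_mul
        (Submodule.pow_mem_pow _ (weylGen_mem_weylGenSpan K n t) (a t)) (ih hl.2 hs')
      have h₂ := Submodule.mul_mem_mul (weylGen_commutator_mem_pow K n s
        (Submodule.pow_mem_pow _ (weylGen_mem_weylGenSpan K n t) (a t)))
        (prod_pow_mem_weylGenSpan_pow K n l a)
      rw [pow_add]
      convert sub_mem h₁ h₂ using 1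
      rw [Finsupp.single_eq_of_ne hst, add_zero]
      simp only [mul_sub, sub_mul, mul_assoc]
      abel

theorem MvPolynomial.IsHomogeneous.degree_eq_of_mem_support {σ R : Type*} [CommSemiring R]
    {p : MvPolynomial σ R} {j : ℕ} (hp : p.IsHomogeneous j) {a : σ →₀ ℕ} (ha : a ∈ p.support) :
    a.degree = j := by
  by_contra h
  exact MvPolynomial.mem_support_iff.1 ha (hp.coeff_eq_zero h)

theorem quantize_mem_bernsteinF {j : ℕ} {p : MvPolynomial (Fin n ⊕ Fin n) K}
    (hp : p.IsHomogeneous j) : quantize K n p ∈ bernsteinF K n j := by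
  rw [p.as_sum, map_sum]
  refine sum_mem fun a ha => ?_
  rw [quantize_monomial]
  refine Submodule.smul_mem _ _ (normalMonomial_mem_bernsteinF K n ?_)
  rw [hp.degree_eq_of_mem_support ha]

theorem quantize_X_mul_sub_mem (s : Fin n ⊕ Fin n) {j : ℕ} {p : MvPolynomial (Fin n ⊕ Fin n) K}
    (hp : p.IsHomogeneous j) :
    quantize K n (MvPolynomial.X s * p) - weylGen K n s * quantize K n p ∈
      weylGenSpan K n ^ j := by
  rw [p.as_sum, Finset.mul_sum, map_sum, map_sum, Finset.mul_sum, ← Finset.sum_sub_distrib]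
  refine sum_mem fun a ha => ?_
  rw [mul_comm, MvPolynomial.X, MvPolynomial.monomial_mul, mul_one, quantize_monomial, quantize_monomial,
    mul_smul_comm]
  have := prod_pow_add_single_sub_mem K n s a _ (nodup_normalOrder n) (mem_normalOrder n s)
  rw [sum_map_normalOrder_eq_degree, hp.degree_eq_of_mem_support ha] at this
  convert Submodule.smul_mem _ (p.coeff a) this using 1
  exact (smul_sub (p.coeff a) (normalMonomial K n (a + Finsupp.single s 1)) _).symm

end WeylAlgebra

theorem MvPolynomial.homogeneousComponent_succ_X_mul {σ R : Type*} [CommSemiring R] (s : σ)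
    (j : ℕ) (p : MvPolynomial σ R) :
    homogeneousComponent (j + 1) (X s * p) = X s * homogeneousComponent j p := by
  classical
  ext d
  by_cases hd : s ∈ d.support
  · obtain ⟨e, rfl⟩ : ∃ e, d = Finsupp.single s 1 + e :=
      le_iff_exists_add.1 (Finsupp.single_le_iff.2
        (Nat.one_le_iff_ne_zero.2 (Finsupp.mem_support_iff.1 hd)))
    simp only [coeff_homogeneousComponent, coeff_X_mul, map_add, Finsupp.degree_single,
      add_comm 1, add_left_inj]
  · simp [coeff_homogeneousComponent, coeff_X_mul', hd]

theorem MvPolynomial.homogeneousComponent_zero_X_mul {σ R : Type*} [CommSemiring R] (s : σ)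
    (p : MvPolynomial σ R) : homogeneousComponent 0 (X s * p) = 0 := by
  classical
  simp [homogeneousComponent_zero, coeff_X_mul']

section Filtrations

variable {K : Type} [Field K] {n : ℕ}
  {N : Type} [AddCommGroup N] [Module K N] [Module (Weyl K n) N] [IsScalarTower K (Weyl K n) N]
  {M : Type} [AddCommGroup M] [Module K M] [Module (Weyl K n) M] [IsScalarTower K (Weyl K n) M]
  {G : ℤ → Submodule K N} {F : ℤ → Submodule K M}

namespace GoodFiltration

theorem monotone (hF : GoodFiltration K n M F) : Monotone F :=
  monotone_int_of_le_succ hF.mono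

theorem weylGen_smul_mem (hF : GoodFiltration K n M F) (s : Fin n ⊕ Fin n) {k : ℤ} {m : M}
    (hm : m ∈ F k) : weylGen K n s • m ∈ F (k + 1) := by
  rw [add_comm]
  exact hF.compat 1 k _ (weylGen_mem_bernsteinF K n s) m hm

theorem pow_smul_mem (hF : GoodFiltration K n M F) {j : ℕ} {k : ℤ} {w : Weyl K n} {m : M}
    (hw : w ∈ weylGenSpan K n ^ j) (hm : m ∈ F k) : w • m ∈ F (k + j) := by
  induction hw using Submodule.pow_induction_on_left' with
  | algebraMap r =>
    rw [algebraMap_smul]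
    simpa using Submodule.smul_mem _ r hm
  | add x y i _ _ hx hy =>
    rw [add_smul]
    exact add_mem hx hy
  | mem_mul w hw i x _ ih =>
    rw [mul_smul]
    convert hF.compat 1 _ w (weylGenSpan_le_bernsteinF K n hw) _ ih using 2
    push_cast
    ring

theorem exists_le (hF : GoodFiltration K n M F) (V : Submodule K M) [FiniteDimensional K V] :
    ∃ c, V ≤ F c := by
  classical
  obtain ⟨s, rfl⟩ := (Submodule.fg_iff_finiteDimensional V).2 inferInstance
  choose c hc using hF.exhaustive
  obtain ⟨C, hC⟩ := (s.image c).exists_le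
  refine ⟨C, Submodule.span_le.2 fun m hm => ?_⟩
  exact hF.monotone (hC _ (Finset.mem_image_of_mem c hm)) (hc m)

/-- A `D_n`-linear map shifts good filtrations by a bounded amount. -/
theorem exists_map_mem (hG : GoodFiltration K n N G) (hF : GoodFiltration K n M F)
    (f : N →ₗ[Weyl K n] M) : ∃ c k₁ : ℤ, ∀ k ≥ k₁, ∀ x ∈ G k, f x ∈ F (k + c) := by
  obtain ⟨k₁, h⟩ := hG.good
  have := hG.finiteDim k₁
  obtain ⟨c, hc⟩ := hF.exists_le ((G k₁).map (f.restrictScalars K))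
  refine ⟨c - k₁, k₁, fun k hk x hx => ?_⟩
  have hx' := h k₁ le_rfl (k - k₁) (by lia) (by simpa using hx)
  suffices Submodule.span K {m | ∃ w ∈ bernsteinF K n (k - k₁), ∃ v ∈ G k₁, m = w • v} ≤
      (F (k + (c - k₁))).comap (f.restrictScalars K) from this hx'
  refine Submodule.span_le.2 ?_
  rintro _ ⟨w, hw, v, hv, rfl⟩
  have := hF.compat (k - k₁) c w hw (f v) (hc ⟨v, hv, rfl⟩)
  simpa [show k + (c - k₁) = k - k₁ + c by ring] using this

theorem map (hG : GoodFiltration K n N G) {f : N →ₗ[Weyl K n] M} (hf : Function.Surjective f) :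
    GoodFiltration K n M fun k => (G k).map (f.restrictScalars K) where
  mono k := Submodule.map_mono (hG.mono k)
  exhaustive m := by
    obtain ⟨x, rfl⟩ := hf m
    obtain ⟨k, hk⟩ := hG.exhaustive x
    exact ⟨k, x, hk, rfl⟩
  compat := by
    rintro j k w hw _ ⟨x, hx, rfl⟩
    exact ⟨w • x, hG.compat j k w hw x hx, f.map_smul w x⟩
  bddBelow := by
    obtain ⟨k₀, h⟩ := hG.bddBelow
    exact ⟨k₀, fun k hk => by simp [h k hk]⟩
  finiteDim k := by
    have := hG.finiteDim k
    infer_instance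
  good := by
    obtain ⟨k₁, h⟩ := hG.good
    refine ⟨k₁, fun k hk j hj => (Submodule.map_mono (h k hk j hj)).trans ?_⟩
    rw [Submodule.map_span]
    refine Submodule.span_mono ?_
    rintro _ ⟨_, ⟨w, hw, v, hv, rfl⟩, rfl⟩
    exact ⟨w, hw, f v, ⟨v, hv, rfl⟩, f.map_smul w v⟩

end GoodFiltration

section SymbolMap

variable {ι : Type} [Fintype ι]

/-- The map `(p_i) ↦ ∑ p_i(x, ∂) v_i` from vectors of commutative polynomials to a `D_n`-module,
using normal ordering. -/
noncomputable def symbolMap (v : ι → M) : (ι → MvPolynomial (Fin n ⊕ Fin n) K) →ₗ[K] M :=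
  ∑ i, (LinearMap.toSpanSingleton (Weyl K n) M (v i)).restrictScalars K ∘ₗ
    quantize K n ∘ₗ LinearMap.proj i

theorem symbolMap_apply (v : ι → M) (p : ι → MvPolynomial (Fin n ⊕ Fin n) K) :
    symbolMap v p = ∑ i, quantize K n (p i) • v i := by
  simp [symbolMap]

theorem GoodFiltration.symbolMap_X_smul_sub_mem (hF : GoodFiltration K n M F) {v : ι → M} {k : ℤ}
    (hv : ∀ i, v i ∈ F k) (s : Fin n ⊕ Fin n) {j : ℕ} {p : ι → MvPolynomial (Fin n ⊕ Fin n) K}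
    (hp : ∀ i, (p i).IsHomogeneous j) :
    symbolMap v ((MvPolynomial.X s : MvPolynomial (Fin n ⊕ Fin n) K) • p) -
      weylGen K n s • symbolMap v p ∈ F (k + j) := by
  rw [symbolMap_apply, symbolMap_apply, Finset.smul_sum, ← Finset.sum_sub_distrib]
  refine sum_mem fun i _ => ?_
  rw [← mul_smul, ← sub_smul]
  exact hF.pow_smul_mem (quantize_X_mul_sub_mem K n s (hp i)) (hv i)

/-- Modulo the previous step, every element of `F (k + j)` is the image of a homogeneous vector
of degree `j`, when `F k` generates. -/
theorem GoodFiltration.exists_symbolMap_sub_mem (hF : GoodFiltration K n M F) {v : ι → M} {k : ℤ}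
    (hv : F k = Submodule.span K (Set.range v)) {j : ℕ}
    (hgood : F (j + k) ≤ Submodule.span K {m | ∃ w ∈ bernsteinF K n j, ∃ v ∈ F k, m = w • v})
    {m : M} (hm : m ∈ F (k + j)) :
    ∃ p : ι → MvPolynomial (Fin n ⊕ Fin n) K, (∀ i, (p i).IsHomogeneous j) ∧
      m - symbolMap v p ∈ F (k + j - 1) := by
  classical
  let H : Submodule K (ι → MvPolynomial (Fin n ⊕ Fin n) K) :=
    Submodule.pi Set.univ fun _ => MvPolynomial.homogeneousSubmodule (Fin n ⊕ Fin n) K j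
  let T : Submodule K M := H.map (symbolMap v) ⊔ F (k + j - 1)
  have hmono (a : Fin n ⊕ Fin n →₀ ℕ) (ha : (a.degree : ℤ) ≤ j) (i : ι) :
      normalMonomial K n a • v i ∈ T := by
    rcases ha.lt_or_eq with ha | ha
    · refine Submodule.mem_sup_right ?_
      have hvi : v i ∈ F k := hv ▸ Submodule.subset_span ⟨i, rfl⟩
      have := hF.compat (j - 1) k _ (normalMonomial_mem_bernsteinF K n (k := j - 1) (a := a)
        (by lia)) _ hvi
      rwa [show k + j - 1 = j - 1 + k by ring]
    · refine Submodule.mem_sup_left ⟨Pi.single i (MvPolynomial.monomial a 1), ?_, ?_⟩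
      · intro i' _
        by_cases h : i' = i
        · subst h
          simpa using MvPolynomial.isHomogeneous_monomial 1 (by exact_mod_cast ha)
        · simp [h]
      · rw [symbolMap_apply, Finset.sum_eq_single i]
        · simp [quantize_monomial]
        · intro i' _ h
          simp [h]
        · simp
  have hspan (w : Weyl K n) (hw : w ∈ bernsteinF K n j) (i : ι) : w • v i ∈ T := by
    rw [bernsteinF_eq_span_normalMonomial] at hw
    induction hw using Submodule.span_induction with
    | mem w hw =>
      obtain ⟨a, ha, rfl⟩ := hw
      exact hmono a ha i
    | zero => simp
    | add x y _ _ hx hy => rw [add_smul]; exact add_mem hx hy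
    | smul r x _ hx => rw [smul_assoc]; exact T.smul_mem r hx
  have hle : F (j + k) ≤ T := by
    refine hgood.trans (Submodule.span_le.2 ?_)
    rintro _ ⟨w, hw, u, hu, rfl⟩
    rw [hv] at hu
    induction hu using Submodule.span_induction with
    | mem u hu =>
      obtain ⟨i, rfl⟩ := hu
      exact hspan w hw i
    | zero => simp
    | add x y _ _ hx hy => rw [smul_add]; exact T.add_mem hx hy
    | smul r x _ hx => rw [smul_algebra_smul_comm]; exact T.smul_mem r hx
  obtain ⟨_, ⟨p, hp, rfl⟩, m', hm', rfl⟩ := Submodule.mem_sup.1 (hle (add_comm k (j : ℤ) ▸ hm))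
  exact ⟨p, fun i => hp i trivial, by simpa using hm'⟩

/-- The vectors of polynomials each of whose homogeneous components has the same symbol as an
element of `N` lying in the step of `G` shifted by `c`. -/
noncomputable def symbolSubmodule (hF : GoodFiltration K n M F) (hG : GoodFiltration K n N G)
    (g : N →ₗ[Weyl K n] M) {v : ι → M} {k : ℤ} (hv : ∀ i, v i ∈ F k) (c : ℤ) :
    Submodule (MvPolynomial (Fin n ⊕ Fin n) K) (ι → MvPolynomial (Fin n ⊕ Fin n) K) where
  carrier := {p | ∀ j : ℕ, symbolMap v (fun i => MvPolynomial.homogeneousComponent j (p i)) ∈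
    (G (j + c)).map (g.restrictScalars K) ⊔ F (k + j - 1)}
  zero_mem' j := by
    simp [symbolMap_apply]
  add_mem' {p q} hp hq j := by
    convert add_mem (hp j) (hq j) using 1
    rw [← map_add]
    congr 1
    ext1 i
    simp
  smul_mem' a p hp := by
    induction a using MvPolynomial.induction_on generalizing p with
    | C r =>
      intro j
      convert Submodule.smul_mem _ r (hp j) using 1
      rw [← map_smul]
      congr 1
      ext1 i
      simp [MvPolynomial.smul_eq_C_mul]
    | add a b ha hb =>
      intro j
      convert add_mem (ha p hp j) (hb p hp j) using 1
      rw [← map_add]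
      congr 1
      ext1 i
      simp [add_mul]
    | mul_X a s ha =>
      have h := ha p hp
      rw [mul_comm, mul_smul]
      generalize a • p = q at h
      rintro (_ | j)
      · simp only [Pi.smul_apply, smul_eq_mul, MvPolynomial.homogeneousComponent_zero_X_mul,
          symbolMap_apply, map_zero, zero_smul, Finset.sum_const_zero, zero_mem]
      · have key : symbolMap v (fun i =>
            MvPolynomial.X s * MvPolynomial.homogeneousComponent j (q i)) -
            weylGen K n s • symbolMap v (fun i => MvPolynomial.homogeneousComponent j (q i)) ∈
              F (k + j) := hF.symbolMap_X_smul_sub_mem hv s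
          (fun i => MvPolynomial.homogeneousComponent_isHomogeneous j (q i))
        obtain ⟨_, ⟨y, hy, rfl⟩, m, hm, hym⟩ := Submodule.mem_sup.1 (h j)
        simp only [Pi.smul_apply, smul_eq_mul, MvPolynomial.homogeneousComponent_succ_X_mul]
        refine Submodule.mem_sup.2 ⟨_, ⟨weylGen K n s • y, ?_, rfl⟩, _, ?_,
          add_sub_cancel _ _⟩
        · have := hG.weylGen_smul_mem s hy
          rwa [show ((j + 1 : ℕ) : ℤ) + c = j + c + 1 by push_cast; ring]
        · rw [show k + ((j + 1 : ℕ) : ℤ) - 1 = k + j by push_cast; ring]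
          have h₂ := hF.weylGen_smul_mem s hm
          rw [sub_add_cancel] at h₂
          convert add_mem key h₂ using 1
          rw [← hym, smul_add]
          simp only [LinearMap.coe_restrictScalars, map_smul]
          abel

end SymbolMap

/-- The filtration induced on a submodule by a good filtration is bounded by a shift of any good
filtration of the submodule. -/
theorem GoodFiltration.exists_mem_of_map_mem (hF : GoodFiltration K n M F)
    (hG : GoodFiltration K n N G) {g : N →ₗ[Weyl K n] M} (hg : Function.Injective g) :
    ∃ c k₁ : ℤ, ∀ k ≥ k₁, ∀ x, g x ∈ F k → x ∈ G (k + c) := by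
  obtain ⟨k₁, hgood⟩ := hF.good
  have := hF.finiteDim k₁
  let b := Module.finBasis K (F k₁)
  let v : Fin (Module.finrank K (F k₁)) → M := fun i => b i
  have hv (i) : v i ∈ F k₁ := (b i).2
  have hspan : F k₁ = Submodule.span K (Set.range v) := by
    have := congrArg (Submodule.map (F k₁).subtype) b.span_eq
    rw [Submodule.map_span, ← Set.range_comp, Submodule.map_subtype_top] at this
    exact this.symm
  let P : ℕ →o Submodule (MvPolynomial (Fin n ⊕ Fin n) K)
      (Fin (Module.finrank K (F k₁)) → MvPolynomial (Fin n ⊕ Fin n) K) :=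
    { toFun := fun c => symbolSubmodule hF hG g hv c
      monotone' := fun c d hcd p hp j => by
        have hle : (j + c : ℤ) ≤ j + d := by lia
        have hsup := sup_le_sup_right
          (Submodule.map_mono (f := g.restrictScalars K) (hG.monotone hle)) (F (k₁ + j - 1))
        exact hsup (hp j) }
  obtain ⟨c₁, hc₁⟩ := monotone_stabilizes_iff_noetherian.2
    (inferInstance : IsNoetherian (MvPolynomial (Fin n ⊕ Fin n) K)
      (Fin (Module.finrank K (F k₁)) → MvPolynomial (Fin n ⊕ Fin n) K)) P
  have hfin : FiniteDimensional K ((F k₁).comap (g.restrictScalars K)) :=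
    FiniteDimensional.of_injective
      (((g.restrictScalars K).restrict fun x hx => hx :
        (F k₁).comap (g.restrictScalars K) →ₗ[K] F k₁))
      fun x y h => Subtype.ext (hg (congrArg Subtype.val h))
  obtain ⟨c₂, hc₂⟩ := hG.exists_le ((F k₁).comap (g.restrictScalars K))
  let c : ℕ := max c₁ c₂.toNat
  have main (j : ℕ) : ∀ x, g x ∈ F (k₁ + j) → x ∈ G (j + c) := by
    induction j with
    | zero =>
      intro x hx
      refine hG.monotone ?_ (hc₂ (x := x) (by simpa using hx))
      simp only [c]
      lia
    | succ j ih =>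
      intro x hx
      obtain ⟨p, hp, hpm⟩ := hF.exists_symbolMap_sub_mem hspan
        (hgood k₁ le_rfl _ (Int.natCast_nonneg _)) hx
      obtain ⟨d, hd⟩ := hG.exhaustive x
      let d' : ℕ := max c d.toNat
      have hpd : p ∈ P d' := by
        intro i
        by_cases hi : i = j + 1
        · subst hi
          have : (fun l => MvPolynomial.homogeneousComponent (j + 1) (p l)) = p := by
            ext1 l
            rw [MvPolynomial.homogeneousComponent_of_mem (hp l), if_pos rfl]
          rw [this]
          refine Submodule.mem_sup.2 ⟨g x, ⟨x, hG.monotone ?_ hd, rfl⟩, _, neg_mem hpm, ?_⟩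
          · simp only [d']
            lia
          · abel
        · have : (fun l => MvPolynomial.homogeneousComponent i (p l)) = 0 := by
            ext1 l
            rw [MvPolynomial.homogeneousComponent_of_mem (hp l), if_neg hi]
            rfl
          rw [this, map_zero]
          exact zero_mem _
      have hpc : p ∈ P c := by
        rwa [← hc₁ c (le_max_left _ _), hc₁ d' ((le_max_left _ _).trans (le_max_left _ _))]
      have hpj := hpc (j + 1)
      have : (fun l => MvPolynomial.homogeneousComponent (j + 1) (p l)) = p := by
        ext1 l
        rw [MvPolynomial.homogeneousComponent_of_mem (hp l), if_pos rfl]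
      rw [this] at hpj
      obtain ⟨_, ⟨y, hy, rfl⟩, m, hm, hym⟩ := Submodule.mem_sup.1 hpj
      have hxy : g (x - y) ∈ F (k₁ + j) := by
        have := add_mem hpm hm
        rw [show k₁ + ((j + 1 : ℕ) : ℤ) - 1 = k₁ + j by push_cast; ring] at this
        convert this using 1
        rw [← hym, map_sub, LinearMap.coe_restrictScalars]
        abel
      have := add_mem (hG.monotone (by push_cast; lia) (ih _ hxy)) hy
      rwa [sub_add_cancel] at this
  refine ⟨c - k₁, k₁, fun k hk x hx => ?_⟩
  have := main (k - k₁).toNat x (by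
    rw [Int.toNat_of_nonneg (by lia)]
    simpa using hx)
  rw [Int.toNat_of_nonneg (by lia)] at this
  rwa [show k + (c - k₁) = k - k₁ + c by ring]

end Filtrations

section Asymptotics

theorem Polynomial.leadingCoeff_nonneg_of_eventually_eval_int {P : Polynomial ℚ} {N : ℤ}
    (h : ∀ k ≥ N, 0 ≤ P.eval (k : ℚ)) : 0 ≤ P.leadingCoeff := by
  by_contra! hlt
  rcases Nat.eq_zero_or_pos P.natDegree with hdeg | hdeg
  · rw [Polynomial.eq_C_of_natDegree_eq_zero hdeg] at h hlt
    have := h N le_rfl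
    rw [Polynomial.eval_C] at this
    rw [Polynomial.leadingCoeff_C] at hlt
    exact absurd this hlt.not_ge
  · have hlim := (P.tendsto_atBot_of_leadingCoeff_nonpos
      (Polynomial.natDegree_pos_iff_degree_pos.1 hdeg) hlt.le).comp
      (tendsto_intCast_atTop_atTop (R := ℚ))
    obtain ⟨k, hk, hk'⟩ := ((hlim.eventually_lt_atBot 0).and
      (Filter.eventually_ge_atTop N)).exists
    exact absurd (h k hk') (not_le.2 hk)

theorem Polynomial.natDegree_le_of_eval_int_le {P Q : Polynomial ℚ} {N c : ℤ}
    (hP : ∀ k ≥ N, 0 ≤ P.eval (k : ℚ))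
    (h : ∀ k ≥ N, P.eval (k : ℚ) ≤ Q.eval ((k + c : ℤ) : ℚ)) : P.natDegree ≤ Q.natDegree := by
  by_contra! hlt
  have hdeg : (Polynomial.taylor (c : ℚ) Q).degree < P.degree := by
    rw [Polynomial.degree_taylor]
    exact Polynomial.degree_lt_degree hlt
  have h₁ := Polynomial.leadingCoeff_nonneg_of_eventually_eval_int hP
  have h₂ := Polynomial.leadingCoeff_nonneg_of_eventually_eval_int
    (P := Polynomial.taylor (c : ℚ) Q - P) (N := N) fun k hk => by
      have := h k hk
      push_cast at this
      rw [Polynomial.eval_sub, Polynomial.taylor_eval]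
      linarith
  rw [Polynomial.leadingCoeff_sub_of_degree_lt' hdeg] at h₂
  have h₀ : P = 0 := Polynomial.leadingCoeff_eq_zero.1 (le_antisymm (by linarith) h₁)
  simp [h₀] at hlt

theorem Polynomial.coeff_taylor_of_natDegree_le {P : Polynomial ℚ} {n : ℕ} (hP : P.natDegree ≤ n)
    (c : ℚ) : (Polynomial.taylor c P).coeff n = P.coeff n := by
  rcases hP.eq_or_lt with rfl | hlt
  · exact Polynomial.coeff_taylor_natDegree c P
  · rw [Polynomial.coeff_eq_zero_of_natDegree_lt hlt,
      Polynomial.coeff_eq_zero_of_natDegree_lt (by rwa [Polynomial.natDegree_taylor])]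

theorem Polynomial.coeff_le_of_eval_int_le {P Q : Polynomial ℚ} {n : ℕ} {N c : ℤ}
    (hP : P.natDegree ≤ n) (hQ : Q.natDegree ≤ n)
    (h : ∀ k ≥ N, P.eval (k : ℚ) ≤ Q.eval ((k + c : ℤ) : ℚ)) : P.coeff n ≤ Q.coeff n := by
  have h₁ := Polynomial.leadingCoeff_nonneg_of_eventually_eval_int
    (P := Polynomial.taylor (c : ℚ) Q - P) (N := N) fun k hk => by
      have := h k hk
      push_cast at this
      rw [Polynomial.eval_sub, Polynomial.taylor_eval]
      linarith
  have hdeg : (Polynomial.taylor (c : ℚ) Q - P).natDegree ≤ n :=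
    (Polynomial.natDegree_sub_le _ _).trans (max_le (by rwa [Polynomial.natDegree_taylor]) hP)
  rcases hdeg.eq_or_lt with heq | hlt
  · rw [Polynomial.leadingCoeff, heq, Polynomial.coeff_sub,
      Polynomial.coeff_taylor_of_natDegree_le hQ] at h₁
    linarith
  · have := Polynomial.coeff_eq_zero_of_natDegree_lt hlt
    rw [Polynomial.coeff_sub, Polynomial.coeff_taylor_of_natDegree_le hQ] at this
    linarith

end Asymptotics

section Multiplicity

variable {K : Type} [Field K] {n : ℕ}
  {N M L : Type} [AddCommGroup N] [Module K N] [Module (Weyl K n) N] [IsScalarTower K (Weyl K n) N]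
  [AddCommGroup M] [Module K M] [Module (Weyl K n) M] [IsScalarTower K (Weyl K n) M]
  [AddCommGroup L] [Module K L] [Module (Weyl K n) L] [IsScalarTower K (Weyl K n) L]

/-- The Hilbert functions of two good filtrations are bounded by shifts of each other. -/
theorem GoodFiltration.exists_finrank_le {F F' : ℤ → Submodule K M}
    (hF : GoodFiltration K n M F) (hF' : GoodFiltration K n M F') :
    ∃ c k₁ : ℤ, ∀ k ≥ k₁, Module.finrank K (F k) ≤ Module.finrank K (F' (k + c)) := by
  obtain ⟨c, k₁, h⟩ := hF.exists_map_mem hF' LinearMap.id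
  refine ⟨c, k₁, fun k hk => ?_⟩
  have := hF'.finiteDim (k + c)
  exact Submodule.finrank_mono fun x hx => h k hk x hx

theorem GoodFiltration.natDegree_le {F F' : ℤ → Submodule K M}
    (hF : GoodFiltration K n M F) (hF' : GoodFiltration K n M F') {h h' : Polynomial ℚ} {a b : ℤ}
    (hh : ∀ k ≥ a, (Module.finrank K (F k) : ℚ) = h.eval (k : ℚ))
    (hh' : ∀ k ≥ b, (Module.finrank K (F' k) : ℚ) = h'.eval (k : ℚ)) :
    h.natDegree ≤ h'.natDegree := by
  obtain ⟨c, k₁, hle⟩ := hF.exists_finrank_le hF'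
  refine Polynomial.natDegree_le_of_eval_int_le (N := max a (max k₁ (b - c))) (c := c)
    (fun k hk => ?_) (fun k hk => ?_)
  · rw [← hh k (by lia)]
    positivity
  · rw [← hh k (by lia), ← hh' (k + c) (by lia)]
    exact_mod_cast hle k (by lia)

theorem IsHolonomic.natDegree_le (hM : IsHolonomic K n M) {F : ℤ → Submodule K M}
    (hF : GoodFiltration K n M F) {h : Polynomial ℚ} {a : ℤ}
    (hh : ∀ k ≥ a, (Module.finrank K (F k) : ℚ) = h.eval (k : ℚ)) :
    h = 0 ∨ h.natDegree = n := by
  rcases hM with hM | ⟨F', hF', h', ⟨b, hh'⟩, hdeg⟩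
  · left
    have hz : ∀ k ≥ a, h.eval (k : ℚ) = 0 := fun k hk => by
      rw [← hh k hk, Module.finrank_zero_of_subsingleton, Nat.cast_zero]
    refine Polynomial.eq_zero_of_infinite_isRoot h ?_
    refine Set.Infinite.mono ?_ ((Set.Ici_infinite a).image (f := fun k : ℤ => (k : ℚ))
      Int.cast_injective.injOn)
    rintro _ ⟨k, hk, rfl⟩
    exact hz k hk
  · exact Or.inr (((hF.natDegree_le hF' hh hh').antisymm (hF'.natDegree_le hF hh' hh)).trans hdeg)

theorem IsHolonomic.exists_of_hasMult (hM : IsHolonomic K n M) {m : ℚ} (hm : HasMult K n M m) :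
    ∃ F : ℤ → Submodule K M, GoodFiltration K n M F ∧ ∃ h : Polynomial ℚ,
      (∃ a : ℤ, ∀ k ≥ a, (Module.finrank K (F k) : ℚ) = h.eval (k : ℚ)) ∧
      h.natDegree ≤ n ∧ m = (Nat.factorial n : ℚ) * h.coeff n := by
  obtain ⟨F, hF, h, ⟨a, hh⟩, rfl⟩ := hm
  refine ⟨F, hF, h, ⟨a, hh⟩, ?_⟩
  rcases hM.natDegree_le hF hh with rfl | rfl
  · simp
  · exact ⟨le_rfl, rfl⟩

theorem finrank_eq_finrank_comap_add_finrank_map {V₁ V₂ V₃ : Type*} [AddCommGroup V₁]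
    [AddCommGroup V₂] [AddCommGroup V₃] [Module K V₁] [Module K V₂] [Module K V₃]
    (g : V₁ →ₗ[K] V₂) (q : V₂ →ₗ[K] V₃) (hg : Function.Injective g)
    (h : LinearMap.range g = LinearMap.ker q) (W : Submodule K V₂) [FiniteDimensional K W] :
    Module.finrank K W =
      Module.finrank K (W.comap g) + Module.finrank K (W.map q) := by
  have hrn := (q.domRestrict W).finrank_range_add_finrank_ker
  rw [LinearMap.range_domRestrict, LinearMap.ker_domRestrict] at hrn
  rw [← hrn, add_comm, (Submodule.equivMapOfInjective g hg (W.comap g)).finrank_eq,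
    Submodule.map_comap_eq, h, ← Submodule.finrank_map_subtype_eq,
    Submodule.map_comap_subtype, inf_comm]

end Multiplicity

/-- Additivity of multiplicity: if `0 → N → M → L → 0` is a
short exact sequence of holonomic left `D_n`-modules, then
`mult M = mult N + mult L`. -/
theorem mult_additive
    (K : Type) [Field K] [CharZero K] (n : ℕ)
    (N M L : Type) [AddCommGroup N] [AddCommGroup M] [AddCommGroup L]
    [Module K N] [Module K M] [Module K L]
    [Module (Weyl K n) N] [Module (Weyl K n) M] [Module (Weyl K n) L]
    [IsScalarTower K (Weyl K n) N] [IsScalarTower K (Weyl K n) M]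
    [IsScalarTower K (Weyl K n) L]
    (g : N →ₗ[Weyl K n] M) (q : M →ₗ[Weyl K n] L)
    (hg : Function.Injective g) (hq : Function.Surjective q)
    (hexact : LinearMap.range g = LinearMap.ker q)
    (hN : IsHolonomic K n N) (hM : IsHolonomic K n M) (hL : IsHolonomic K n L) :
    ∀ a b c : ℚ, HasMult K n N a → HasMult K n M b → HasMult K n L c →
      b = a + c := by
  intro a b c ha hb hc
  obtain ⟨FN, hFN, h₁, ⟨k₁, hh₁⟩, hd₁, rfl⟩ := hN.exists_of_hasMult ha
  obtain ⟨FM, hFM, h₂, ⟨k₂, hh₂⟩, hd₂, rfl⟩ := hM.exists_of_hasMult hb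
  obtain ⟨FL, hFL, h₃, ⟨k₃, hh₃⟩, hd₃, rfl⟩ := hL.exists_of_hasMult hc
  have hrank (k : ℤ) : (Module.finrank K (FM k) : ℚ) =
      Module.finrank K ((FM k).comap (g.restrictScalars K)) +
        Module.finrank K ((FM k).map (q.restrictScalars K)) := by
    have := hFM.finiteDim k
    exact_mod_cast finrank_eq_finrank_comap_add_finrank_map (g.restrictScalars K)
      (q.restrictScalars K) hg
      (SetLike.coe_injective (congrArg (fun S : Submodule (Weyl K n) M => (S : Set M)) hexact))
      (FM k)
  have hcomap (k : ℤ) : FiniteDimensional K ((FM k).comap (g.restrictScalars K)) := by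
    have := hFM.finiteDim k
    exact FiniteDimensional.of_injective
      ((g.restrictScalars K).restrict fun x hx => hx :
        (FM k).comap (g.restrictScalars K) →ₗ[K] FM k)
      fun x y h => Subtype.ext (hg (congrArg Subtype.val h))
  obtain ⟨c₁, l₁, hu₁⟩ := hFM.exists_mem_of_map_mem hFN hg
  obtain ⟨c₂, l₂, hu₂⟩ := (hFM.map hq).exists_finrank_le hFL
  obtain ⟨c₃, l₃, hu₃⟩ := hFN.exists_map_mem hFM g
  obtain ⟨c₄, l₄, hu₄⟩ := hFL.exists_finrank_le (hFM.map hq)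
  have hdeg (s t : ℚ) : (Polynomial.taylor s h₁ + Polynomial.taylor t h₃).natDegree ≤ n :=
    (Polynomial.natDegree_add_le _ _).trans
      (max_le (by rwa [Polynomial.natDegree_taylor]) (by rwa [Polynomial.natDegree_taylor]))
  have hcoeff (s t : ℚ) : (Polynomial.taylor s h₁ + Polynomial.taylor t h₃).coeff n =
      h₁.coeff n + h₃.coeff n := by
    rw [Polynomial.coeff_add, Polynomial.coeff_taylor_of_natDegree_le hd₁,
      Polynomial.coeff_taylor_of_natDegree_le hd₃]
  have hle : h₂.coeff n ≤ h₁.coeff n + h₃.coeff n := by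
    rw [← hcoeff c₁ c₂]
    refine Polynomial.coeff_le_of_eval_int_le (c := 0)
      (N := max (max (max k₂ l₁) l₂) (max (k₁ - c₁) (k₃ - c₂))) hd₂ (hdeg _ _) fun k hk => ?_
    rw [Polynomial.eval_add, Polynomial.taylor_eval, Polynomial.taylor_eval, add_zero,
      ← Int.cast_add, ← Int.cast_add, ← hh₁ _ (by lia), ← hh₂ _ (by lia), ← hh₃ _ (by lia), hrank]
    have := hFN.finiteDim (k + c₁)
    have hsub : (FM k).comap (g.restrictScalars K) ≤ FN (k + c₁) :=
      fun x hx => hu₁ k (by lia) x hx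
    exact_mod_cast add_le_add (Submodule.finrank_mono hsub) (hu₂ k (by lia))
  have hge : h₁.coeff n + h₃.coeff n ≤ h₂.coeff n := by
    rw [← hcoeff (-c₃ : ℤ) (-c₄ : ℤ)]
    refine Polynomial.coeff_le_of_eval_int_le (c := 0)
      (N := max (max (max k₂ (l₃ + c₃)) (l₄ + c₄)) (max (k₁ + c₃) (k₃ + c₄))) (hdeg _ _) hd₂
      fun k hk => ?_
    rw [Polynomial.eval_add, Polynomial.taylor_eval, Polynomial.taylor_eval, add_zero,
      ← Int.cast_add, ← Int.cast_add, ← hh₁ _ (by lia), ← hh₂ _ (by lia), ← hh₃ _ (by lia), hrank]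
    have hsub : FN (k + -c₃) ≤ (FM k).comap (g.restrictScalars K) := fun x hx => by
      have := hu₃ _ (by lia) x hx
      rwa [neg_add_cancel_right] at this
    have hmap := hu₄ (k + -c₄) (by lia)
    rw [neg_add_cancel_right] at hmap
    exact_mod_cast add_le_add (Submodule.finrank_mono hsub) hmap
  rw [hle.antisymm hge, mul_add]
end
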